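/- Let a > b > 0 and let λ, μ, ν be real numbers with μ + ν + 1 > λ, ν > −1, μ > −1, and such that (λ + μ − ν + 1)/2 is not a nonpositive integer. Then lim_{ε→0+} ∫_0^∞ e^{−εt} t^{−λ} J_μ(at) J_ν(bt) dt = ( b^ν Γ((μ+ν−λ+1)/2) / ( 2^λ a^{ν−λ+1} Γ(ν+1) Γ((λ+μ−ν+1)/2) ) ) · F( (μ+ν−λ+1)/2 , (ν−λ−μ+1)/2 ; ν+1 ; b²/a² ). -/

import Mathlib

open MeasureTheory Real Filter

noncomputable def besselJ (ν t : ℝ) : ℝ :=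
  ∑' r : ℕ, (-1 : ℝ) ^ r * t ^ (ν + 2 * (r : ℝ)) /
    ((2 : ℝ) ^ (ν + 2 * (r : ℝ)) * (Nat.factorial r : ℝ) * Real.Gamma (ν + (r : ℝ) + 1))

noncomputable def besselI (ν t : ℝ) : ℝ :=
  ∑' r : ℕ, t ^ (ν + 2 * (r : ℝ)) /
    ((2 : ℝ) ^ (ν + 2 * (r : ℝ)) * (Nat.factorial r : ℝ) * Real.Gamma (ν + (r : ℝ) + 1))

noncomputable def besselK (ν t : ℝ) : ℝ :=
  Real.pi / (2 * Real.sin (ν * Real.pi)) * (besselI (-ν) t - besselI ν t)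

noncomputable def besselN (ν t : ℝ) : ℝ :=
  (besselJ ν t * Real.cos (ν * Real.pi) - besselJ (-ν) t) / Real.sin (ν * Real.pi)

noncomputable def hyperF (a b c z : ℝ) : ℝ :=
  ∑' m : ℕ, ((ascPochhammer ℝ m).eval a * (ascPochhammer ℝ m).eval b /
    (ascPochhammer ℝ m).eval c) * z ^ m / (Nat.factorial m : ℝ)

/-- Coefficients of the normalised Bessel function. -/
noncomputable def jc (μ : ℝ) (r : ℕ) : ℝ :=
  (-1 : ℝ) ^ r / (4 ^ r * (Nat.factorial r : ℝ) * Real.Gamma (μ + r + 1))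

/-- Normalised Bessel function `(x/2)^(-μ) J_μ(x)`. -/
noncomputable def jj (μ x : ℝ) : ℝ := ∑' r : ℕ, jc μ r * x ^ (2 * r)

lemma jc_bound {μ : ℝ} (hμ : -1 < μ) : ∃ C : ℝ, 0 < C ∧ ∀ r : ℕ, |jc μ r| ≤ C / (Nat.factorial r : ℝ) := by
  have h1 : 0 < Real.Gamma (μ + 1) := Real.Gamma_pos_of_pos (by linarith)
  have h2 : 0 < Real.Gamma (μ + 2) := Real.Gamma_pos_of_pos (by linarith)
  have key : ∀ r : ℕ, Real.Gamma (μ + 2) ≤ Real.Gamma (μ + 2 + r) := by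
    intro r
    induction r with
    | zero => simp
    | succ n ih =>
      have hn : (0:ℝ) ≤ n := Nat.cast_nonneg n
      have : Real.Gamma (μ + 2 + (n + 1 : ℕ)) = (μ + 2 + n) * Real.Gamma (μ + 2 + n) := by
        rw [← Real.Gamma_add_one (by linarith)]
        push_cast; ring_nf
      rw [this]
      nlinarith
  refine ⟨1 / Real.Gamma (μ + 1) + 1 / Real.Gamma (μ + 2), by positivity, fun r => ?_⟩
  have hfac : (0:ℝ) < (Nat.factorial r : ℝ) := by positivity
  have hg : 0 < Real.Gamma (μ + r + 1) := Real.Gamma_pos_of_pos (by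
    have hn : (0:ℝ) ≤ r := Nat.cast_nonneg r
    linarith)
  have hle : 1 / Real.Gamma (μ + r + 1) ≤ 1 / Real.Gamma (μ + 1) + 1 / Real.Gamma (μ + 2) := by
    rcases r with _ | n
    · simp; positivity
    · have := key n
      have e : μ + ((n+1 : ℕ):ℝ) + 1 = μ + 2 + n := by push_cast; ring
      rw [e]
      have : 1 / Real.Gamma (μ + 2 + n) ≤ 1 / Real.Gamma (μ + 2) := one_div_le_one_div_of_le h2 this
      have : 0 < 1 / Real.Gamma (μ + 1) := by positivity
      linarith
  have h4 : (1:ℝ) ≤ 4 ^ r := one_le_pow₀ (by norm_num)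
  rw [jc, abs_div, abs_pow, abs_neg, abs_one, one_pow, abs_of_pos (by positivity)]
  calc 1 / (4 ^ r * (Nat.factorial r : ℝ) * Real.Gamma (μ + r + 1))
      = (1 / 4 ^ r) * (1 / Real.Gamma (μ + r + 1)) / (Nat.factorial r : ℝ) := by field_simp
    _ ≤ 1 * (1 / Real.Gamma (μ + 1) + 1 / Real.Gamma (μ + 2)) / (Nat.factorial r : ℝ) := by
        gcongr
        rw [div_le_one (by positivity)]; exact h4
    _ = _ := by rw [one_mul]

lemma jc_summable {μ : ℝ} (hμ : -1 < μ) (x : ℝ) : Summable fun r : ℕ => |jc μ r * x ^ (2 * r)| := by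
  obtain ⟨C, hC, h⟩ := jc_bound hμ
  have := (Real.summable_pow_div_factorial (x ^ 2)).mul_left C
  refine Summable.of_nonneg_of_le (fun r => abs_nonneg _) (fun r => ?_) this
  rw [abs_mul, pow_mul, abs_of_nonneg (by positivity : (0:ℝ) ≤ (x^2)^r)]
  have := h r
  calc |jc μ r| * (x ^ 2) ^ r ≤ C / (Nat.factorial r : ℝ) * (x ^ 2) ^ r := by gcongr
    _ = _ := by ring

lemma jj_continuous {μ : ℝ} (hμ : -1 < μ) : Continuous (jj μ) := by
  rw [continuous_iff_continuousAt]
  intro x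
  have hc : ContinuousOn (jj μ) (Set.Ioo (-(|x| + 1)) (|x| + 1)) := by
    refine continuousOn_tsum (u := fun r => |jc μ r * (|x| + 1) ^ (2 * r)|) (fun r => by fun_prop)
      (jc_summable hμ _) (fun r y hy => ?_)
    rw [Real.norm_eq_abs, abs_mul, abs_mul, abs_pow, abs_pow]
    have : |y| ≤ |x| + 1 := abs_le.2 ⟨hy.1.le, hy.2.le⟩
    exact mul_le_mul_of_nonneg_left (pow_le_pow_left₀ (abs_nonneg _) (this.trans (le_abs_self _)) _) (abs_nonneg _)
  refine hc.continuousAt (Ioo_mem_nhds ?_ ?_)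
  · linarith [neg_abs_le x]
  · linarith [le_abs_self x]

lemma rGamma (x : ℝ) : x / Real.Gamma (x + 1) = 1 / Real.Gamma x := by
  by_cases h : x = 0
  · simp [h, Real.Gamma_zero]
  · rw [Real.Gamma_add_one h]; field_simp

lemma jj_rec {μ : ℝ} (hμ : -1 < μ) (x : ℝ) :
    jj μ x = (μ + 1) * jj (μ + 1) x - x ^ 2 / 4 * jj (μ + 2) x := by
  have s0 := (jc_summable hμ x).of_abs
  have s1 := (jc_summable (show -1 < μ + 1 by linarith) x).of_abs
  have s2 := (jc_summable (show -1 < μ + 2 by linarith) x).of_abs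
  have h1 := (s1.mul_left (μ+1)).hasSum
  rw [tsum_mul_left] at h1
  -- shifted
  have h2 : HasSum (fun r : ℕ => (r : ℝ) * (jc (μ+1) r * x ^ (2 * r))) (- (x ^ 2 / 4 * jj (μ + 2) x)) := by
    rw [← hasSum_nat_add_iff' 1]
    simp only [Finset.range_one, Finset.sum_singleton, Nat.cast_zero, zero_mul, sub_zero]
    have := (s2.hasSum.mul_left (-(x^2/4)))
    rw [neg_mul] at this
    refine this.congr_fun fun r => ?_
    simp only [jc]
    have hn : (0:ℝ) ≤ r := Nat.cast_nonneg r
    have hg : 0 < Real.Gamma (μ + 2 + r + 1) := Real.Gamma_pos_of_pos (by linarith)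
    have e : μ + 1 + ((r + 1 : ℕ) : ℝ) + 1 = μ + 2 + r + 1 := by push_cast; ring
    rw [e, Nat.factorial_succ]
    push_cast
    field_simp
    ring
  have h3 := h1.add h2
  have : (fun r : ℕ => (μ+1) * (jc (μ+1) r * x ^ (2*r)) + (r : ℝ) * (jc (μ+1) r * x ^ (2 * r)))
      = fun r : ℕ => jc μ r * x ^ (2*r) := by
    funext r
    have := rGamma (μ + r + 1)
    simp only [jc]
    rw [show μ + 1 + (r:ℝ) + 1 = μ + r + 1 + 1 by ring]
    have e : (-1:ℝ) ^ r / (4 ^ r * (Nat.factorial r : ℝ) * Real.Gamma (μ + r + 1))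
      = (-1:ℝ) ^ r / (4 ^ r * (Nat.factorial r : ℝ)) * (1 / Real.Gamma (μ + r + 1)) := by
        rw [div_mul_div_comm, mul_one]
    rw [e, ← this]
    ring
  rw [this] at h3
  rw [jj, h3.tsum_eq, ← jj]; simp only [jj]; ring

lemma besselJ_eq {ν t : ℝ} (ht : 0 < t) : besselJ ν t = (t / 2) ^ ν * jj ν t := by
  rw [besselJ, jj, ← tsum_mul_left]
  congr 1; funext r
  rw [Real.rpow_add ht, Real.rpow_add two_pos, Real.div_rpow ht.le two_pos.le, jc]
  have e1 : t ^ (2 * (r:ℝ)) = t ^ (2 * r) := by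
    rw [← Real.rpow_natCast]; push_cast; rfl
  have e2 : (2:ℝ) ^ (2 * (r:ℝ)) = 4 ^ r := by
    rw [show (2:ℝ) * (r:ℝ) = ((2 * r : ℕ):ℝ) by push_cast; rfl, Real.rpow_natCast, pow_mul]; norm_num
  rw [e1, e2]
  field_simp

lemma beta_int {α β : ℝ} (hα : 0 < α) (hβ : 0 < β) :
    IntegrableOn (fun v : ℝ => v ^ (α - 1) * (1 - v) ^ (β - 1)) (Set.Ioo 0 1) ∧
    ∫ v in Set.Ioo (0:ℝ) 1, v ^ (α - 1) * (1 - v) ^ (β - 1) =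
      Real.Gamma α * Real.Gamma β / Real.Gamma (α + β) := by
  have hc := Complex.betaIntegral_convergent (u := α) (v := β) (by simpa) (by simpa)
  rw [intervalIntegrable_iff_integrableOn_Ioo_of_le zero_le_one] at hc
  have hval := ProbabilityTheory.beta_eq_betaIntegralReal α β hα hβ
  have hcongr : Set.EqOn (fun x : ℝ => (x:ℂ) ^ ((α:ℂ) - 1) * (1 - (x:ℂ)) ^ ((β:ℂ) - 1))
      (fun v : ℝ => ((v ^ (α - 1) * (1 - v) ^ (β - 1) : ℝ) : ℂ)) (Set.Ioo 0 1) := by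
    intro v hv
    simp only
    rw [Complex.ofReal_mul, Complex.ofReal_cpow hv.1.le, Complex.ofReal_cpow (by linarith [hv.2])]
    push_cast; rfl
  have hc2 := (integrableOn_congr_fun hcongr measurableSet_Ioo).1 hc
  refine ⟨?_, ?_⟩
  · have := hc2.re
    simpa [IntegrableOn] using this
  · rw [ProbabilityTheory.beta, Complex.betaIntegral, intervalIntegral.integral_of_le zero_le_one,
      integral_Ioc_eq_integral_Ioo, setIntegral_congr_fun measurableSet_Ioo hcongr,
      integral_complex_ofReal, Complex.ofReal_re] at hval
    exact hval.symm

lemma beta_moment {α β : ℝ} (hα : 0 < α) (hβ : 0 < β) {c : ℕ → ℝ} (hc : Summable fun r => |c r|) :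
    HasSum (fun r : ℕ => c r * (Real.Gamma (α + r) * Real.Gamma β / Real.Gamma (α + β + r)))
      (∫ v in Set.Ioo (0:ℝ) 1, v ^ (α - 1) * (1 - v) ^ (β - 1) * ∑' r, c r * v ^ r) := by
  have hα' : ∀ r : ℕ, 0 < α + r := fun r => by positivity
  have hcongr : ∀ r : ℕ, Set.EqOn (fun v : ℝ => c r * (v ^ (α + r - 1) * (1 - v) ^ (β - 1)))
      (fun v : ℝ => v ^ (α - 1) * (1 - v) ^ (β - 1) * (c r * v ^ r)) (Set.Ioo 0 1) := by
    intro r v hv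
    simp only
    rw [show α + r - 1 = α - 1 + r by ring, Real.rpow_add hv.1, Real.rpow_natCast]; ring
  have hIntg : ∀ r : ℕ, IntegrableOn (fun v : ℝ => v ^ (α - 1) * (1 - v) ^ (β - 1) * (c r * v ^ r)) (Set.Ioo 0 1) :=
    fun r => (integrableOn_congr_fun (hcongr r) measurableSet_Ioo).1 ((beta_int (hα' r) hβ).1.const_mul _)
  have h0 := beta_int hα hβ
  have key := hasSum_integral_of_summable_integral_norm (μ := volume.restrict (Set.Ioo (0:ℝ) 1))
    (F := fun (r : ℕ) (v : ℝ) => v ^ (α - 1) * (1 - v) ^ (β - 1) * (c r * v ^ r)) hIntg (by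
      refine Summable.of_nonneg_of_le (fun r => integral_nonneg fun _ => norm_nonneg _) (fun r => ?_)
        (hc.mul_right (∫ v in Set.Ioo (0:ℝ) 1, v ^ (α - 1) * (1 - v) ^ (β - 1)))
      rw [← integral_const_mul]
      refine setIntegral_mono_on (hIntg r).norm (h0.1.const_mul _) measurableSet_Ioo fun v hv => ?_
      have hv0 := hv.1
      have hv1 : 0 < 1 - v := by linarith [hv.2]
      have hw : 0 ≤ v ^ (α - 1) * (1 - v) ^ (β - 1) := by positivity
      rw [Real.norm_eq_abs, abs_mul, abs_of_nonneg hw, abs_mul, abs_of_nonneg (by positivity : 0 ≤ v ^ r), mul_comm]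
      gcongr
      exact mul_le_of_le_one_right (abs_nonneg _) (pow_le_one₀ hv0.le hv.2.le))
  simp only [tsum_mul_left] at key
  refine key.congr_fun fun r => ?_
  rw [← setIntegral_congr_fun measurableSet_Ioo (hcongr r), integral_const_mul, (beta_int (hα' r) hβ).2,
    show α + β + r = α + r + β by ring]

lemma sonine {κ β : ℝ} (hκ : -1 < κ) (hβ : 0 < β) (x : ℝ) :
    jj (κ + β) x = 1 / Real.Gamma β *
      ∫ v in Set.Ioo (0:ℝ) 1, v ^ κ * (1 - v) ^ (β - 1) * jj κ (x * √v) := by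
  have h := beta_moment (α := κ + 1) (β := β) (by linarith) hβ (jc_summable hκ x)
  have hG := Real.Gamma_pos_of_pos hβ
  rw [setIntegral_congr_fun (g := fun v => v ^ (κ + 1 - 1) * (1 - v) ^ (β - 1) *
    ∑' r, jc κ r * x ^ (2 * r) * v ^ r) measurableSet_Ioo]
  · rw [← h.tsum_eq, ← tsum_mul_left, jj]
    congr 1; funext r
    have h1 : 0 < Real.Gamma (κ + r + 1) := Real.Gamma_pos_of_pos (by
      have : (0:ℝ) ≤ r := Nat.cast_nonneg r
      linarith)
    simp only [jc]
    rw [show κ + 1 + β + r = κ + β + r + 1 by ring, show κ + 1 + (r:ℝ) = κ + r + 1 by ring]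
    field_simp
  · intro v hv
    simp only [jj, add_sub_cancel_right]
    congr 2; funext r
    rw [mul_pow, pow_mul (√v), Real.sq_sqrt hv.1.le]; ring

lemma jj_neg_half (x : ℝ) : jj (-1/2) x = Real.cos x / √π := by
  have h := (Real.hasSum_cos x).div_const (√π)
  rw [jj, ← h.tsum_eq]
  congr 1; funext r
  have : Real.Gamma (-1/2 + r + 1) = Nat.factorial (2 * r) / (4 ^ r * Nat.factorial r) * √π := by
    have := Real.Gamma_nat_add_half r
    induction r with
    | zero => 
      rw [show (-1/2 + ((0:ℕ):ℝ) + 1) = 1/2 by norm_num, Real.Gamma_one_half_eq]; simp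
    | succ n ih =>
      rw [show (-1/2 + ((n+1 : ℕ):ℝ) + 1) = (-1/2 + (n:ℝ) + 1) + 1 by push_cast; ring, Real.Gamma_add_one (by
        have : (0:ℝ) ≤ n := Nat.cast_nonneg n
        linarith), ih (Real.Gamma_nat_add_half n)]
      rw [show 2 * (n + 1) = 2 * n + 1 + 1 by ring, Nat.factorial_succ, Nat.factorial_succ, Nat.factorial_succ]
      push_cast
      field_simp
      ring
  rw [jc, this]
  have : 0 < √π := Real.sqrt_pos.2 Real.pi_pos
  field_simp

/-- Continuous functions of subexponential growth on `[0,∞)`. -/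
def SubExp (f : ℝ → ℝ) : Prop :=
  Continuous f ∧ ∀ δ : ℝ, 0 < δ → ∃ C : ℝ, 0 ≤ C ∧ ∀ t : ℝ, 0 ≤ t → |f t| ≤ C * Real.exp (δ * t)

lemma SubExp.mul {f g : ℝ → ℝ} (hf : SubExp f) (hg : SubExp g) : SubExp fun t => f t * g t := by
  refine ⟨hf.1.mul hg.1, fun δ hδ => ?_⟩
  obtain ⟨C, hC, h1⟩ := hf.2 (δ/2) (by positivity)
  obtain ⟨D, hD, h2⟩ := hg.2 (δ/2) (by positivity)
  refine ⟨C * D, by positivity, fun t ht => ?_⟩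
  rw [abs_mul]
  calc _ ≤ (C * Real.exp (δ/2 * t)) * (D * Real.exp (δ/2 * t)) := by
        gcongr
        exacts [h1 t ht, h2 t ht]
    _ = C * D * (Real.exp (δ/2 * t) * Real.exp (δ/2 * t)) := by ring
    _ = _ := by rw [← Real.exp_add]; ring_nf

lemma SubExp.add {f g : ℝ → ℝ} (hf : SubExp f) (hg : SubExp g) : SubExp fun t => f t + g t := by
  refine ⟨hf.1.add hg.1, fun δ hδ => ?_⟩
  obtain ⟨C, hC, h1⟩ := hf.2 δ hδ
  obtain ⟨D, hD, h2⟩ := hg.2 δ hδ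
  refine ⟨C + D, by positivity, fun t ht => ?_⟩
  rw [add_mul]
  exact (abs_add_le _ _).trans (add_le_add (h1 t ht) (h2 t ht))

lemma SubExp.of_bounded {f : ℝ → ℝ} (hf : Continuous f) {C : ℝ} (h : ∀ t, |f t| ≤ C) : SubExp f := by
  refine ⟨hf, fun δ hδ => ⟨|C|, abs_nonneg _, fun t ht => ?_⟩⟩
  exact ((h t).trans (le_abs_self C)).trans (le_mul_of_one_le_right (abs_nonneg _) (Real.one_le_exp (by positivity)))

lemma SubExp.const (c : ℝ) : SubExp fun _ => c := .of_bounded continuous_const (C := |c|) fun _ => le_rfl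

lemma SubExp.id : SubExp fun t => t := by
  refine ⟨continuous_id, fun δ hδ => ⟨1/δ, by positivity, fun t ht => ?_⟩⟩
  rw [abs_of_nonneg ht]
  have := Real.add_one_le_exp (δ * t)
  rw [one_div, inv_mul_eq_div, le_div_iff₀ hδ]; linarith

lemma SubExp.scale {f : ℝ → ℝ} (hf : SubExp f) {a : ℝ} (ha : 0 ≤ a) : SubExp fun t => f (a * t) := by
  refine ⟨hf.1.comp (by fun_prop), fun δ hδ => ?_⟩
  obtain ⟨C, hC, h1⟩ := hf.2 (δ/(a+1)) (by positivity)
  refine ⟨C, hC, fun t ht => (h1 _ (by positivity)).trans ?_⟩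
  refine mul_le_mul_of_nonneg_left (Real.exp_le_exp.2 ?_) hC
  rw [div_mul_eq_mul_div, div_le_iff₀ (by positivity)]
  nlinarith [mul_nonneg hδ.le ht]

lemma jj_subexp_aux {μ : ℝ} (hμ : -1/2 < μ) : SubExp (jj μ) := by
  have hb := beta_int (α := 1/2) (β := μ + 1/2) (by norm_num) (by linarith)
  refine .of_bounded (jj_continuous (by linarith)) (C := |1 / Real.Gamma (μ + 1/2)| *
    ∫ v in Set.Ioo (0:ℝ) 1, (v ^ ((1:ℝ)/2 - 1) * (1 - v) ^ (μ + 1/2 - 1)) * (1 / √π)) fun x => ?_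
  have := sonine (κ := -1/2) (β := μ + 1/2) (by norm_num) (by linarith) x
  rw [show -1/2 + (μ + 1/2) = μ by ring] at this
  rw [this, abs_mul]
  gcongr
  rw [← Real.norm_eq_abs]
  refine norm_integral_le_of_norm_le (hb.1.mul_const _) ?_
  filter_upwards [self_mem_ae_restrict measurableSet_Ioo] with v hv
  have hv0 := hv.1
  have hv1 : 0 < 1 - v := by linarith [hv.2]
  have hw : 0 ≤ v ^ (-1/2:ℝ) * (1 - v) ^ (μ + 1/2 - 1) := by positivity
  rw [norm_mul, Real.norm_of_nonneg hw, show (1:ℝ)/2 - 1 = -1/2 by norm_num]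
  gcongr
  rw [jj_neg_half, Real.norm_eq_abs, abs_div, abs_of_nonneg (Real.sqrt_nonneg π)]
  gcongr
  exact Real.abs_cos_le_one _

lemma jj_subexp {μ : ℝ} (hμ : -1 < μ) : SubExp (jj μ) := by
  have h1 := (SubExp.const (μ + 1)).mul (jj_subexp_aux (μ := μ + 1) (by linarith))
  have h2 := ((SubExp.const (-1/4)).mul (SubExp.id.mul SubExp.id)).mul (jj_subexp_aux (μ := μ + 2) (by linarith))
  have h3 := h1.add h2
  convert h3 using 1
  funext x
  rw [jj_rec hμ]; ring

noncomputable def lapR (p : ℝ) (f : ℝ → ℝ) (ε : ℝ) : ℝ :=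
  ∫ t in Set.Ioi (0:ℝ), Real.exp (-ε * t) * (t ^ (p - 1) * f t)

noncomputable def lap (p : ℝ) (f : ℝ → ℝ) (z : ℂ) : ℂ :=
  ∫ t in Set.Ioi (0:ℝ), Complex.exp (-z * t) * ((t ^ (p - 1) * f t : ℝ) : ℂ)

lemma exp_rpow_int {p ε : ℝ} (hp : 0 < p) (hε : 0 < ε) :
    IntegrableOn (fun t : ℝ => Real.exp (-ε * t) * t ^ (p - 1)) (Set.Ioi 0) := by
  have := integrableOn_rpow_mul_exp_neg_mul_rpow (p := 1) (s := p - 1) (b := ε) (by linarith) one_pos hε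
  simp only [Real.rpow_one] at this
  simpa only [mul_comm] using this

lemma exp_rpow_val {p ε : ℝ} (hp : 0 < p) (hε : 0 < ε) :
    ∫ t in Set.Ioi (0:ℝ), Real.exp (-ε * t) * t ^ (p - 1) = Real.Gamma p * ε ^ (-p) := by
  have := Real.integral_rpow_mul_exp_neg_mul_Ioi hp hε
  rw [one_div, Real.inv_rpow hε.le, ← Real.rpow_neg hε.le] at this
  rw [mul_comm, ← this]
  congr 1; funext t
  rw [mul_comm, neg_mul]

lemma lap_meas {p : ℝ} {f : ℝ → ℝ} (hf : Continuous f) :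
    Measurable (fun t : ℝ => t ^ (p - 1) * f t) :=
  (measurable_id.pow_const _).mul hf.measurable

lemma lapR_int {p ε : ℝ} {f : ℝ → ℝ} (hp : 0 < p) (hf : SubExp f) (hε : 0 < ε) :
    IntegrableOn (fun t : ℝ => Real.exp (-ε * t) * (t ^ (p - 1) * f t)) (Set.Ioi 0) := by
  obtain ⟨C, hC, h⟩ := hf.2 (ε/2) (by positivity)
  refine Integrable.mono' ((exp_rpow_int hp (half_pos hε)).const_mul C) ?_ ?_
  · exact ((by fun_prop : Measurable fun t : ℝ => Real.exp (-ε * t)).mul (lap_meas hf.1)).aestronglyMeasurable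
  · filter_upwards [self_mem_ae_restrict measurableSet_Ioi] with t ht
    have ht0 : 0 < t := ht
    have := h t ht0.le
    rw [norm_mul, norm_mul, Real.norm_of_nonneg (Real.exp_pos _).le, Real.norm_of_nonneg (by positivity : 0 ≤ t ^ (p-1)), Real.norm_eq_abs]
    calc _ ≤ Real.exp (-ε * t) * (t ^ (p - 1) * (C * Real.exp (ε/2*t))) := by gcongr
      _ = C * (Real.exp (-ε * t) * Real.exp (ε/2*t) * t ^ (p - 1)) := by ring
      _ = _ := by rw [← Real.exp_add]; ring_nf

lemma lap_norm (z : ℂ) (t x : ℝ) : ‖Complex.exp (-z * t) * (x : ℂ)‖ = Real.exp (-z.re * t) * |x| := by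
  rw [norm_mul, Complex.norm_exp, Complex.norm_real, Real.norm_eq_abs]; simp

lemma lap_aesm {p : ℝ} {f : ℝ → ℝ} (hf : Continuous f) (z : ℂ) :
    AEStronglyMeasurable (fun t : ℝ => Complex.exp (-z * t) * ((t ^ (p - 1) * f t : ℝ) : ℂ))
      (volume.restrict (Set.Ioi 0)) :=
  ((by fun_prop : Measurable fun t : ℝ => Complex.exp (-z * t)).mul
    (Complex.measurable_ofReal.comp (lap_meas hf))).aestronglyMeasurable

lemma lap_int {p : ℝ} {f : ℝ → ℝ} (hp : 0 < p) (hf : SubExp f) {z : ℂ} (hz : 0 < z.re) :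
    IntegrableOn (fun t : ℝ => Complex.exp (-z * t) * ((t ^ (p - 1) * f t : ℝ) : ℂ)) (Set.Ioi 0) := by
  refine Integrable.mono' (lapR_int hp hf hz).norm (lap_aesm hf.1 z) ?_
  filter_upwards with t
  rw [lap_norm, norm_mul, Real.norm_of_nonneg (Real.exp_pos _).le, Real.norm_eq_abs]

lemma lap_ofReal (p : ℝ) (f : ℝ → ℝ) (ε : ℝ) : lap p f ε = (lapR p f ε : ℂ) := by
  rw [lap, lapR, ← integral_complex_ofReal]
  congr 1; funext t
  push_cast; rfl

lemma lap_re {p : ℝ} {f : ℝ → ℝ} (hp : 0 < p) (hf : SubExp f) {ε : ℝ} (hε : 0 < ε) (y : ℝ) :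
    (lap p f (ε + y * Complex.I)).re = lapR p (fun t => f t * Real.cos (y * t)) ε := by
  have h := lap_int hp hf (z := ε + y * Complex.I) (by simpa using hε)
  have h2 := integral_re h
  simp only [RCLike.re_to_complex] at h2
  rw [lap, ← h2, lapR]
  congr 1; funext t
  rw [Complex.re_mul_ofReal, Complex.exp_re]
  simp
  ring

lemma lap_deriv {p : ℝ} {f : ℝ → ℝ} (hp : 0 < p) (hf : SubExp f) {z : ℂ} (hz : 0 < z.re) :
    HasDerivAt (lap p f) (-(lap (p+1) f z)) z := by
  have hopen : {w : ℂ | z.re / 2 < w.re} ∈ nhds z :=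
    (isOpen_lt continuous_const Complex.continuous_re).mem_nhds (by simp; linarith)
  have key := hasDerivAt_integral_of_dominated_loc_of_deriv_le (μ := volume.restrict (Set.Ioi (0:ℝ)))
    (F := fun (w : ℂ) (t : ℝ) => Complex.exp (-w * t) * ((t ^ (p - 1) * f t : ℝ) : ℂ))
    (F' := fun (w : ℂ) (t : ℝ) => -(t:ℂ) * Complex.exp (-w * t) * ((t ^ (p - 1) * f t : ℝ) : ℂ))
    (bound := fun t => ‖Real.exp (-(z.re/2) * t) * (t ^ (p + 1 - 1) * f t)‖)
    (x₀ := z) hopen (Eventually.of_forall fun w => lap_aesm hf.1 w) (lap_int hp hf hz) ?_ ?_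
    (lapR_int (by linarith) hf (half_pos hz)).norm ?_
  · have h2 := key.2
    rw [lap, ← integral_neg]
    convert! h2 using 1
    refine setIntegral_congr_fun measurableSet_Ioi fun t ht => ?_
    have ht0 : (0:ℝ) < t := ht
    rw [show p + 1 - 1 = (p - 1) + 1 by ring, Real.rpow_add_one ht0.ne']
    push_cast; ring
  · exact (((by fun_prop : Measurable fun t : ℝ => -(t:ℂ) * Complex.exp (-z * t)).mul
      (Complex.measurable_ofReal.comp (lap_meas hf.1)))).aestronglyMeasurable
  · filter_upwards [self_mem_ae_restrict measurableSet_Ioi] with t ht w hw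
    have ht0 : (0:ℝ) < t := ht
    have hw' : z.re / 2 < w.re := hw
    rw [mul_assoc, norm_mul, lap_norm, norm_neg, Complex.norm_real, Real.norm_of_nonneg ht0.le,
      norm_mul, Real.norm_of_nonneg (Real.exp_pos _).le, show p + 1 - 1 = (p - 1) + 1 by ring,
      Real.rpow_add_one ht0.ne', Real.norm_eq_abs,
      show t ^ (p-1) * t * f t = t * (t ^ (p-1) * f t) by ring, abs_mul t, abs_of_pos ht0]
    have : Real.exp (-w.re * t) ≤ Real.exp (-(z.re/2) * t) := Real.exp_le_exp.2 (by nlinarith)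
    have h0 := abs_nonneg (t ^ (p-1) * f t)
    calc _ ≤ t * (Real.exp (-(z.re/2) * t) * |t ^ (p-1) * f t|) := by gcongr
      _ = _ := by ring
  · filter_upwards with t w hw
    have : HasDerivAt (fun w : ℂ => -w * t) (-(t:ℂ)) w := by
      simpa using ((hasDerivAt_id w).neg.mul_const (t:ℂ))
    have h3 := (this.cexp).mul_const ((t ^ (p - 1) * f t : ℝ) : ℂ)
    convert! h3 using 1
    ring

lemma lap_diffOn {p : ℝ} {f : ℝ → ℝ} (hp : 0 < p) (hf : SubExp f) :
    DifferentiableOn ℂ (lap p f) {z | 0 < z.re} :=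
  fun _ hz => (lap_deriv hp hf hz).differentiableAt.differentiableWithinAt

lemma isOpen_rhp : IsOpen {z : ℂ | 0 < z.re} := isOpen_lt continuous_const Complex.continuous_re

lemma convex_rhp : Convex ℝ {z : ℂ | 0 < z.re} := convex_halfSpace_re_gt 0

lemma ident {U : Set ℂ} (hU : IsOpen U) (hc : IsPreconnected U) {f g : ℂ → ℂ}
    (hf : DifferentiableOn ℂ f U) (hg : DifferentiableOn ℂ g U) {c d : ℝ} (hcd : c < d)
    (hsub : ∀ x : ℝ, c < x → x < d → (x : ℂ) ∈ U)
    (heq : ∀ x : ℝ, c < x → x < d → f x = g x) : Set.EqOn f g U := by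
  set m := (c + d) / 2
  have hm : (m : ℂ) ∈ U := hsub m (by simp only [m]; linarith) (by simp only [m]; linarith)
  refine (hf.analyticOnNhd hU).eqOn_of_preconnected_of_frequently_eq (hg.analyticOnNhd hU) hc hm ?_
  have ht : Tendsto (fun x : ℝ => (x : ℂ)) (nhdsWithin m (Set.Ioi m)) (nhdsWithin (m:ℂ) {(m:ℂ)}ᶜ) := by
    refine tendsto_nhdsWithin_of_tendsto_nhds_of_eventually_within _ ?_ ?_
    · exact (Complex.continuous_ofReal.tendsto m).mono_left nhdsWithin_le_nhds
    · filter_upwards [self_mem_nhdsWithin] with x hx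
      simp only [Set.mem_compl_iff, Set.mem_singleton_iff, Complex.ofReal_inj]
      exact (ne_of_gt hx)
  refine ht.frequently (Eventually.frequently ?_)
  have hmd : m < d := by simp only [m]; linarith
  filter_upwards [Ioo_mem_nhdsGT hmd] with x hx
  exact heq x (by have := hx.1; simp only [m] at this; linarith) hx.2

lemma lap_series {p z : ℝ} (hp : 0 < p) (hz : 0 < z) (k : ℕ) {c : ℕ → ℝ}
    (hs : Summable fun r : ℕ => |c r| * (Real.Gamma (p + k * r) * z ^ (-(p + k * r)))) :
    HasSum (fun r : ℕ => c r * (Real.Gamma (p + k * r) * z ^ (-(p + k * r))))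
      (lapR p (fun t => ∑' r, c r * t ^ (k * r)) z) := by
  have hp' : ∀ r : ℕ, 0 < p + k * r := fun r => by positivity
  have hcongr : ∀ r : ℕ, Set.EqOn (fun t : ℝ => c r * (Real.exp (-z * t) * t ^ (p + k * r - 1)))
      (fun t : ℝ => Real.exp (-z * t) * (t ^ (p - 1) * (c r * t ^ (k * r)))) (Set.Ioi 0) := by
    intro r t ht
    simp only
    rw [show p + k * r - 1 = p - 1 + ((k * r : ℕ):ℝ) by push_cast; ring, Real.rpow_add ht, Real.rpow_natCast]; ring
  have hIntg : ∀ r : ℕ, IntegrableOn (fun t : ℝ => Real.exp (-z * t) * (t ^ (p - 1) * (c r * t ^ (k * r)))) (Set.Ioi 0) :=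
    fun r => (integrableOn_congr_fun (hcongr r) measurableSet_Ioi).1 ((exp_rpow_int (hp' r) hz).const_mul _)
  have key := hasSum_integral_of_summable_integral_norm (μ := volume.restrict (Set.Ioi (0:ℝ)))
    (F := fun (r : ℕ) (t : ℝ) => Real.exp (-z * t) * (t ^ (p - 1) * (c r * t ^ (k * r)))) hIntg (by
      refine hs.congr fun r => ?_
      rw [← exp_rpow_val (hp' r) hz, ← integral_const_mul]
      refine setIntegral_congr_fun measurableSet_Ioi fun t ht => ?_
      have ht0 : (0:ℝ) < t := ht
      have := hcongr r ht
      simp only at this ⊢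
      rw [← this, norm_mul, Real.norm_eq_abs, Real.norm_of_nonneg (by positivity)])
  simp only [tsum_mul_left] at key
  refine key.congr_fun fun r => ?_
  rw [← setIntegral_congr_fun measurableSet_Ioi (hcongr r), integral_const_mul, exp_rpow_val (hp' r) hz]

lemma jc_succ {μ : ℝ} (hμ : -1 < μ) (r : ℕ) :
    jc μ (r+1) = - jc μ r / (4 * (r + 1) * (μ + r + 1)) := by
  have hr : (0:ℝ) ≤ r := Nat.cast_nonneg r
  have h0 : 0 < μ + r + 1 := by linarith
  have hg := Real.Gamma_pos_of_pos h0
  simp only [jc]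
  rw [show μ + ((r+1:ℕ):ℝ) + 1 = μ + r + 1 + 1 by push_cast; ring, Real.Gamma_add_one h0.ne', Nat.factorial_succ]
  push_cast
  field_simp
  ring

lemma jc_ne {μ : ℝ} (hμ : -1 < μ) (r : ℕ) : jc μ r ≠ 0 := by
  have hr : (0:ℝ) ≤ r := Nat.cast_nonneg r
  have hg := Real.Gamma_pos_of_pos (show 0 < μ + r + 1 by linarith)
  rw [jc]; positivity

lemma tend_lin (A B C : ℝ) : Tendsto (fun n : ℕ => (A + B * n) / (C + n)) atTop (nhds B) := by
  have := tendsto_add_mul_div_add_mul_atTop_nhds A C B (one_ne_zero (α := ℝ))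
  simpa using this

lemma Gamma_two {q : ℝ} (hq : 0 < q) : Real.Gamma (q + 2) = (q + 1) * (q * Real.Gamma q) := by
  rw [show q + 2 = q + 1 + 1 by ring, Real.Gamma_add_one (by linarith), Real.Gamma_add_one hq.ne']

lemma jc_lap_summable {μ p a z : ℝ} (hμ : -1 < μ) (hp : 0 < p) (ha : 0 < a) (haz : a < z) :
    Summable fun r : ℕ => |jc μ r * a ^ (2 * r)| * (Real.Gamma (p + (2:ℕ) * r) * z ^ (-(p + (2:ℕ) * r))) := by
  have hz : 0 < z := ha.trans haz
  have hG : ∀ r : ℕ, 0 < Real.Gamma (p + (2:ℕ) * r) := fun r => Real.Gamma_pos_of_pos (by positivity)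
  have hpos : ∀ r : ℕ, 0 < |jc μ r * a ^ (2 * r)| * (Real.Gamma (p + (2:ℕ) * r) * z ^ (-(p + (2:ℕ) * r))) := by
    intro r
    have := hG r
    have := jc_ne hμ r
    positivity
  have hl : a ^ 2 / z ^ 2 < 1 := by
    rw [div_lt_one (by positivity)]; gcongr
  refine summable_of_ratio_test_tendsto_lt_one hl (Eventually.of_forall fun r => (hpos r).ne') ?_
  have h1 := ((tend_lin p 2 1).mul (tend_lin (p+1) 2 (μ+1))).const_mul (a^2/z^2/4)
  rw [show a^2/z^2/4*(2*2) = a^2/z^2 by ring] at h1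
  refine h1.congr fun r => ?_
  rw [Real.norm_of_nonneg (hpos _).le, Real.norm_of_nonneg (hpos _).le, jc_succ hμ]
  have hr : (0:ℝ) ≤ r := Nat.cast_nonneg r
  have h0 : 0 < μ + r + 1 := by linarith
  have h0' : 0 < μ + 1 + r := by linarith
  have e1 : p + (2:ℕ) * ((r+1:ℕ):ℝ) = p + (2:ℕ) * (r:ℝ) + 2 := by push_cast; ring
  have e2 : z ^ (-(p + (2:ℕ) * (r:ℝ) + 2)) = z ^ (-(p + (2:ℕ) * (r:ℝ))) / z ^ 2 := by
    rw [neg_add, Real.rpow_add hz, Real.rpow_neg hz.le 2, Real.rpow_two]; rfl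
  rw [e1, e2, Gamma_two (by positivity), abs_mul, abs_mul, abs_div, abs_neg, abs_of_pos (by positivity : 0 < 4 * ((r:ℝ)+1) * (μ + r + 1)),
    show 2 * (r+1) = 2 * r + 2 by ring, pow_add, abs_mul _ (a^2), abs_of_pos (by positivity : 0 < a^2)]
  have := hG r
  have h5 : 0 < |jc μ r| := abs_pos.2 (jc_ne hμ r)
  have h6 : 0 < |a ^ (2*r)| := by positivity
  have h7 : 0 < z ^ (-(p + (2:ℕ) * (r:ℝ))) := by positivity
  have e3 : μ + 1 + r = μ + r + 1 := by ring
  rw [e3]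
  field_simp
  push_cast
  ring

lemma lap_jj {μ p a z : ℝ} (hμ : -1 < μ) (hp : 0 < p) (ha : 0 < a) (haz : a < z) :
    HasSum (fun r : ℕ => jc μ r * a ^ (2 * r) * (Real.Gamma (p + 2 * r) * z ^ (-(p + 2 * r))))
      (lapR p (fun t => jj μ (a * t)) z) := by
  have := lap_series hp (ha.trans haz) 2 (jc_lap_summable hμ hp ha haz)
  convert! this using 1
  congr 1; funext t
  rw [jj]; congr 1; funext r
  rw [mul_pow]; ring

lemma jj_scale_subexp {μ a : ℝ} (hμ : -1 < μ) (ha : 0 ≤ a) : SubExp (fun t => jj μ (a * t)) :=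
  (jj_subexp hμ).scale ha

lemma ode_real {μ p a x : ℝ} (hμ : -1 < μ) (hp : 0 < p) (ha : 0 < a) (hx : a < x) :
    (x ^ 2 + a ^ 2) * lapR (p+2) (fun t => jj μ (a * t)) x
      - (2 * (p - μ) + 1) * x * lapR (p+1) (fun t => jj μ (a * t)) x
      + p * (p - 2 * μ) * lapR p (fun t => jj μ (a * t)) x = 0 := by
  have hx0 : 0 < x := ha.trans hx
  have hA := lap_jj hμ (show 0 < p + 2 by linarith) ha hx
  have hB := lap_jj hμ (show 0 < p + 1 by linarith) ha hx
  have hC := lap_jj hμ hp ha hx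
  have e1 : ∀ r : ℕ, x ^ (-(p + 2 + 2 * (r:ℝ))) = x ^ (-(p + 2 * (r:ℝ))) / x ^ 2 := fun r => by
    rw [show -(p + 2 + 2 * (r:ℝ)) = -(p + 2 * (r:ℝ)) + -2 by ring, Real.rpow_add hx0, Real.rpow_neg hx0.le 2, Real.rpow_two]; rfl
  have e2 : ∀ r : ℕ, x ^ (-(p + 1 + 2 * (r:ℝ))) = x ^ (-(p + 2 * (r:ℝ))) / x := fun r => by
    rw [show -(p + 1 + 2 * (r:ℝ)) = -(p + 2 * (r:ℝ)) + -1 by ring, Real.rpow_add hx0, Real.rpow_neg_one]; rfl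
  have g1 : ∀ r : ℕ, Real.Gamma (p + 2 + 2 * (r:ℝ)) = (p + 2 * r + 1) * ((p + 2 * r) * Real.Gamma (p + 2 * r)) := fun r => by
    rw [show p + 2 + 2 * (r:ℝ) = p + 2 * r + 2 by ring, Gamma_two (by positivity)]
  have g2 : ∀ r : ℕ, Real.Gamma (p + 1 + 2 * (r:ℝ)) = (p + 2 * r) * Real.Gamma (p + 2 * r) := fun r => by
    rw [show p + 1 + 2 * (r:ℝ) = p + 2 * r + 1 by ring, Real.Gamma_add_one (by positivity)]
  have hD := ((hA.mul_left (x^2)).sub (hB.mul_left ((2 * (p - μ) + 1) * x))).add (hC.mul_left (p * (p - 2 * μ)))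
  have hE : HasSum (fun r : ℕ => 4 * r * (r + μ) * (jc μ r * a ^ (2 * r) * (Real.Gamma (p + 2 * r) * x ^ (-(p + 2 * r)))))
      (-(a^2 * lapR (p+2) (fun t => jj μ (a * t)) x)) := by
    rw [← hasSum_nat_add_iff' 1]
    simp only [Finset.range_one, Finset.sum_singleton, Nat.cast_zero, zero_mul, mul_zero, sub_zero]
    refine (hA.mul_left (a^2)).neg.congr_fun fun r => ?_
    have hr : (0:ℝ) ≤ r := Nat.cast_nonneg r
    have h0 : μ + r + 1 ≠ 0 := by linarith
    rw [jc_succ hμ, show p + 2 + 2 * (r:ℝ) = p + 2 * ((r+1 : ℕ):ℝ) by push_cast; ring]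
    push_cast
    rw [show 2 * (r+1) = 2 * r + 2 by ring, pow_add]
    rw [show (r:ℝ) + 1 + μ = μ + r + 1 by ring]
    field_simp
  have hF : (fun r : ℕ => 4 * r * (r + μ) * (jc μ r * a ^ (2 * r) * (Real.Gamma (p + 2 * r) * x ^ (-(p + 2 * (r:ℝ)))))) = _ :=
    funext fun r => show _ = _ from by
      have : 4 * r * (r + μ) * (jc μ r * a ^ (2 * r) * (Real.Gamma (p + 2 * r) * x ^ (-(p + 2 * (r:ℝ)))))
        = x ^ 2 * (jc μ r * a ^ (2 * r) * (Real.Gamma (p + 2 + 2 * r) * x ^ (-(p + 2 + 2 * (r:ℝ)))))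
          - (2 * (p - μ) + 1) * x * (jc μ r * a ^ (2 * r) * (Real.Gamma (p + 1 + 2 * r) * x ^ (-(p + 1 + 2 * (r:ℝ)))))
          + p * (p - 2 * μ) * (jc μ r * a ^ (2 * r) * (Real.Gamma (p + 2 * r) * x ^ (-(p + 2 * (r:ℝ))))) := by
        rw [e1, e2, g1, g2]
        field_simp
        ring
      exact this
  rw [hF] at hE
  have := hD.unique hE
  linarith

lemma ode_complex {μ p a : ℝ} (hμ : -1 < μ) (hp : 0 < p) (ha : 0 < a) {z : ℂ} (hz : 0 < z.re) :
    (z ^ 2 + (a:ℂ) ^ 2) * lap (p+2) (fun t => jj μ (a * t)) z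
      - (2 * (p - μ) + 1) * z * lap (p+1) (fun t => jj μ (a * t)) z
      + p * (p - 2 * μ) * lap p (fun t => jj μ (a * t)) z = 0 := by
  have hf := jj_scale_subexp hμ ha.le
  have d2 := lap_diffOn (show 0 < p + 2 by linarith) hf
  have d1 := lap_diffOn (show 0 < p + 1 by linarith) hf
  have d0 := lap_diffOn hp hf
  have := ident isOpen_rhp convex_rhp.isPreconnected (f := fun z => (z ^ 2 + (a:ℂ) ^ 2) * lap (p+2) (fun t => jj μ (a * t)) z
      - (2 * (p - μ) + 1) * z * lap (p+1) (fun t => jj μ (a * t)) z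
      + p * (p - 2 * μ) * lap p (fun t => jj μ (a * t)) z) (g := fun _ => 0)
      (by fun_prop) (by fun_prop) (c := a) (d := a + 1) (by linarith) (fun x hx _ => by simp; linarith)
      (fun x hx _ => by
        simp only [lap_ofReal]
        exact_mod_cast ode_real hμ hp ha hx)
  exact this hz

lemma base1_real {α y x : ℝ} (hα : 0 < α) (hy : 0 < y) (hx : y < x) :
    lapR (2 * α) (fun t => jj (α - 1/2) (y * t)) x
      = Real.Gamma (2 * α) / Real.Gamma (α + 1/2) * (x ^ 2 + y ^ 2) ^ (-α) := by
  have hx0 : 0 < x := hy.trans hx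
  have hμ : -1 < α - 1/2 := by linarith
  have h1 := lap_jj hμ (show 0 < 2 * α by linarith) hy hx
  have hs := jc_lap_summable hμ (show 0 < 2 * α by linarith) hy hx
  have hpi : 0 < √π := Real.sqrt_pos.2 Real.pi_pos
  set q : ℝ := (y / x) ^ 2 with hq
  set K : ℝ := 2 ^ (2 * α - 1) / √π * x ^ (-(2 * α)) with hK
  have hKpos : 0 < K := by positivity
  have term : ∀ r : ℕ, jc (α - 1/2) r * y ^ (2 * r) * (Real.Gamma (2 * α + 2 * r) * x ^ (-(2 * α + 2 * r)))
      = K * ((-q) ^ r / (Nat.factorial r : ℝ) * (Real.Gamma (α + (1:ℕ) * r) * 1 ^ (-(α + (1:ℕ) * (r:ℝ))))) := by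
    intro r
    have hd := Real.Gamma_mul_Gamma_add_half (α + r)
    have hg1 : 0 < Real.Gamma (α + r + 1/2) := Real.Gamma_pos_of_pos (by positivity)
    have e0 : (2:ℝ) ^ (1 - 2 * (α + r)) = 1 / (2 ^ (2 * α - 1) * 4 ^ r) := by
      rw [show 1 - 2 * (α + r) = -((2 * α - 1) + ((2 * r : ℕ) : ℝ)) by push_cast; ring, Real.rpow_neg two_pos.le, Real.rpow_add two_pos,
        Real.rpow_natCast, pow_mul]; norm_num
    have e1 : Real.Gamma (2 * α + 2 * r) = Real.Gamma (α + r) * Real.Gamma (α + r + 1/2) * (2 ^ (2 * α - 1) * 4 ^ r) / √π := by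
      rw [hd, e0, show 2 * (α + (r:ℝ)) = 2 * α + 2 * r by ring]
      field_simp
    have e2 : x ^ (-(2 * α + 2 * (r:ℝ))) = x ^ (-(2 * α)) / x ^ (2 * r) := by
      rw [show -(2 * α + 2 * (r:ℝ)) = -(2 * α) + -((2 * r : ℕ):ℝ) by push_cast; ring, Real.rpow_add hx0, Real.rpow_neg hx0.le ((2 * r : ℕ):ℝ), Real.rpow_natCast]; rfl
    rw [e1, e2, jc, hK, hq, Real.one_rpow, Nat.cast_one, one_mul, show α - 1/2 + r + 1 = α + r + 1/2 by ring]
    rw [show (-(y / x)^2)^r = (-1)^r * (y ^ (2 * r) / x ^ (2 * r)) by rw [neg_pow, ← pow_mul, div_pow]]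
    field_simp
  have hs2 : Summable fun r : ℕ => |(-q) ^ r / (Nat.factorial r : ℝ)| * (Real.Gamma (α + (1:ℕ) * r) * 1 ^ (-(α + (1:ℕ) * (r:ℝ)))) := by
    have := hs.mul_left (1/K)
    refine this.congr fun r => ?_
    have ht := congrArg abs (term r)
    have hgp : 0 < Real.Gamma (α + (1:ℕ) * r) := Real.Gamma_pos_of_pos (by positivity)
    have hgq : 0 < Real.Gamma (2 * α + 2 * r) := Real.Gamma_pos_of_pos (by positivity)
    rw [abs_mul, abs_of_pos (by positivity : 0 < Real.Gamma (2 * α + 2 * r) * x ^ (-(2 * α + 2 * (r:ℝ)))), abs_mul K, abs_of_pos hKpos, abs_mul (_ / _),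
      abs_of_pos (by positivity : 0 < Real.Gamma (α + (1:ℕ) * r) * (1:ℝ) ^ (-(α + (1:ℕ) * (r:ℝ))))] at ht
    push_cast at ht ⊢
    rw [ht]
    field_simp
  have h2 := (lap_series hα one_pos 1 hs2).mul_left K
  have h3 : HasSum _ _ := h1
  simp_rw [term] at h3
  have h4 := h3.unique h2
  rw [h4]
  have hq0 : 0 ≤ q := by positivity
  have h5 : lapR α (fun t => ∑' r : ℕ, (-q) ^ r / (Nat.factorial r : ℝ) * t ^ (1 * r)) 1 = Real.Gamma α * (1 + q) ^ (-α) := by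
    rw [← exp_rpow_val hα (show 0 < 1 + q by linarith), lapR]
    congr 1; funext t
    have : (∑' r : ℕ, (-q) ^ r / (Nat.factorial r : ℝ) * t ^ (1 * r)) = Real.exp (-q * t) := by
      rw [Real.exp_eq_exp_ℝ, NormedSpace.exp_eq_tsum_div]
      congr 1; funext r
      rw [mul_pow, one_mul]; ring
    rw [this, show -(1 + q) * t = -1 * t + -q * t by ring, Real.exp_add]; ring
  rw [h5]
  have hd := Real.Gamma_mul_Gamma_add_half α
  have hg1 : 0 < Real.Gamma (α + 1/2) := Real.Gamma_pos_of_pos (by positivity)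
  have e3 : (x ^ 2 + y ^ 2) ^ (-α) = x ^ (-(2 * α)) * (1 + q) ^ (-α) := by
    rw [show x ^ 2 + y ^ 2 = x ^ 2 * (1 + q) by rw [hq]; field_simp, Real.mul_rpow (by positivity) (by positivity), ← Real.rpow_natCast, ← Real.rpow_mul hx0.le]
    congr 2; push_cast; ring
  have e4 : (2:ℝ) ^ (1 - 2 * α) = 1 / 2 ^ (2 * α - 1) := by
    rw [show 1 - 2 * α = -(2 * α - 1) by ring, Real.rpow_neg two_pos.le, one_div]
  rw [e4] at hd
  rw [e3, hK]
  field_simp at hd ⊢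
  linear_combination hd

lemma base1 {α y ε : ℝ} (hα : 0 < α) (hy : 0 < y) (hε : 0 < ε) :
    lapR (2 * α) (fun t => jj (α - 1/2) (y * t)) ε
      = Real.Gamma (2 * α) / Real.Gamma (α + 1/2) * (ε ^ 2 + y ^ 2) ^ (-α) := by
  have hμ : -1 < α - 1/2 := by linarith
  have hf := jj_scale_subexp hμ hy.le
  have hd := lap_diffOn (show 0 < 2 * α by linarith) hf
  have cast_eq : ∀ x : ℝ, 0 < x → (((Real.Gamma (2 * α) / Real.Gamma (α + 1/2) * (x ^ 2 + y ^ 2) ^ (-α) : ℝ)) : ℂ)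
      = ((Real.Gamma (2 * α) / Real.Gamma (α + 1/2) : ℝ) : ℂ) * ((x:ℂ) ^ 2 + (y:ℂ) ^ 2) ^ (-α : ℂ) := by
    intro x hx
    rw [Complex.ofReal_mul, Complex.ofReal_cpow (by positivity)]
    push_cast; rfl
  have := ident isOpen_rhp convex_rhp.isPreconnected (f := lap (2 * α) (fun t => jj (α - 1/2) (y * t)))
    (g := fun z => ((Real.Gamma (2 * α) / Real.Gamma (α + 1/2) : ℝ) : ℂ) * (z ^ 2 + (y:ℂ) ^ 2) ^ (-α : ℂ)) hd ?_
    (c := y) (d := y + 1) (by linarith) (fun x hx _ => by simp; linarith)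
    (fun x hx _ => by
      rw [lap_ofReal, base1_real hα hy hx]
      exact cast_eq x (hy.trans hx))
  · have h := this (show (ε : ℂ) ∈ {z : ℂ | 0 < z.re} by simpa using hε)
    simp only at h
    rw [lap_ofReal, ← cast_eq ε hε] at h
    exact_mod_cast h
  · intro z hz
    have hz' : 0 < z.re := hz
    refine DifferentiableAt.differentiableWithinAt ?_
    refine DifferentiableAt.const_mul (DifferentiableAt.cpow_const (by fun_prop) ?_) _
    rw [Complex.mem_slitPlane_iff]
    by_cases him : z.im = 0
    · left
      simp [pow_two, him]
      nlinarith
    · right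
      simp [pow_two]
      intro h
      rcases mul_eq_zero.1 (show z.re * z.im = 0 by linarith) with h | h
      · linarith
      · exact him h

lemma fubini_jj {κ β p b ε : ℝ} {f : ℝ → ℝ} (hκ : -1 < κ) (hβ : 0 < β) (hp : 0 < p) (hb : 0 ≤ b)
    (hf : SubExp f) (hε : 0 < ε) :
    lapR p (fun t => f t * jj (κ + β) (b * t)) ε = 1 / Real.Gamma β *
      ∫ v in Set.Ioo (0:ℝ) 1, v ^ κ * (1 - v) ^ (β - 1) * lapR p (fun t => f t * jj κ (b * √v * t)) ε := by
  obtain ⟨C, hC, hbd⟩ := (jj_scale_subexp hκ hb).2 (ε/2) (by positivity)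
  have hw := (beta_int (α := κ + 1) (β := β) (by linarith) hβ).1
  simp only [add_sub_cancel_right] at hw
  have hG := (lapR_int hp hf (half_pos hε)).norm
  have hjc := jj_continuous hκ
  have hIntg : Integrable (Function.uncurry fun (t v : ℝ) =>
      Real.exp (-ε * t) * (t ^ (p - 1) * (f t * (v ^ κ * (1 - v) ^ (β - 1) * jj κ (b * √v * t)))))
      ((volume.restrict (Set.Ioi (0:ℝ))).prod (volume.restrict (Set.Ioo (0:ℝ) 1))) := by
    refine Integrable.mono' ((hG.mul_prod hw).const_mul C) ?_ ?_
    · refine Measurable.aestronglyMeasurable ?_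
      have h1 : Measurable fun x : ℝ × ℝ => x.1 ^ (p-1) := measurable_fst.pow_const _
      have h2 : Measurable fun x : ℝ × ℝ => x.2 ^ κ := measurable_snd.pow_const _
      have h3 : Measurable fun x : ℝ × ℝ => (1 - x.2) ^ (β - 1) := (measurable_const.sub measurable_snd).pow_const _
      have h4 : Measurable fun x : ℝ × ℝ => jj κ (b * √x.2 * x.1) := by
        refine (hjc.comp (by fun_prop)).measurable
      have h5 : Measurable fun x : ℝ × ℝ => f x.1 := (hf.1.comp continuous_fst).measurable
      have h6 : Measurable fun x : ℝ × ℝ => Real.exp (-ε * x.1) := by fun_prop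
      exact h6.mul (h1.mul (h5.mul ((h2.mul h3).mul h4)))
    · rw [Measure.prod_restrict]
      filter_upwards [self_mem_ae_restrict (measurableSet_Ioi.prod measurableSet_Ioo)] with x hx
      obtain ⟨t, v⟩ := x
      obtain ⟨ht, hv⟩ := hx
      have ht : 0 < t := ht
      have hv0 : 0 < v := hv.1
      have hv1 : 0 < 1 - v := sub_pos.2 hv.2
      have hs1 : √v ≤ 1 := Real.sqrt_le_one.2 hv.2.le
      have hs0 : 0 ≤ √v := Real.sqrt_nonneg v
      have h1 : |jj κ (b * √v * t)| ≤ C * Real.exp (ε / 2 * t) := by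
        have : |jj κ (b * (√v * t))| ≤ _ := hbd (√v * t) (by positivity)
        rw [← mul_assoc] at this
        refine this.trans ?_
        gcongr
        nlinarith
      simp only [Function.uncurry, norm_mul, Real.norm_eq_abs, Real.abs_exp]
      have e : Real.exp (-ε * t) * Real.exp (ε / 2 * t) = Real.exp (-(ε/2) * t) := by
        rw [← Real.exp_add]; congr 1; ring
      rw [← e]
      rw [abs_of_pos (Real.rpow_pos_of_pos hv0 κ), abs_of_pos (Real.rpow_pos_of_pos hv1 _)]
      calc _ = (Real.exp (-ε * t) * |t ^ (p-1)| * |f t| * v ^ κ * (1-v)^(β-1)) * |jj κ (b * √v * t)| := by ring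
        _ ≤ (Real.exp (-ε * t) * |t ^ (p-1)| * |f t| * v ^ κ * (1-v)^(β-1)) * (C * Real.exp (ε / 2 * t)) := by
          gcongr
        _ = _ := by ring
  have hsw := integral_integral_swap hIntg
  have e1 : lapR p (fun t => f t * jj (κ + β) (b * t)) ε = 1 / Real.Gamma β *
      ∫ t in Set.Ioi (0:ℝ), ∫ v in Set.Ioo (0:ℝ) 1, Real.exp (-ε * t) * (t ^ (p - 1) * (f t * (v ^ κ * (1 - v) ^ (β - 1) * jj κ (b * √v * t)))) := by
    rw [lapR, ← integral_const_mul]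
    congr 1; funext t
    rw [sonine hκ hβ, integral_const_mul, integral_const_mul, integral_const_mul]
    simp only [show ∀ v : ℝ, b * t * √v = b * √v * t from fun v => by ring]
    ring
  rw [e1, hsw]
  congr 2; funext v
  rw [lapR, ← integral_const_mul]
  congr 1; funext t
  ring

noncomputable def gg (μ a p : ℝ) : ℝ := 2 ^ (p - 1) * a ^ (-p) * Real.Gamma (p / 2) / Real.Gamma (μ + 1 - p / 2)

lemma lapR_add {p ε : ℝ} {f g : ℝ → ℝ} (hp : 0 < p) (hε : 0 < ε) (hf : SubExp f) (hg : SubExp g) (A B : ℝ) :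
    lapR p (fun t => A * f t + B * g t) ε = A * lapR p f ε + B * lapR p g ε := by
  rw [lapR, lapR, lapR, ← integral_const_mul, ← integral_const_mul,
    ← integral_add ((lapR_int hp hf hε).const_mul A) ((lapR_int hp hg hε).const_mul B)]
  congr 1; funext t; ring

lemma lapR_sq {p ε : ℝ} {f : ℝ → ℝ} :
    lapR p (fun t => t ^ 2 * f t) ε = lapR (p + 2) f ε := by
  rw [lapR, lapR]
  refine setIntegral_congr_fun measurableSet_Ioi fun t ht => ?_
  have ht : 0 < t := ht
  rw [show p + 2 - 1 = p - 1 + 2 by ring, Real.rpow_add ht, Real.rpow_two]; ring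

lemma lapR_rec {p ε ν b : ℝ} {f : ℝ → ℝ} (hp : 0 < p) (hε : 0 < ε) (hf : SubExp f) (hν : -1 < ν) (hb : 0 ≤ b) :
    lapR p (fun t => f t * jj ν (b * t)) ε = (ν + 1) * lapR p (fun t => f t * jj (ν + 1) (b * t)) ε
      - b ^ 2 / 4 * lapR (p + 2) (fun t => f t * jj (ν + 2) (b * t)) ε := by
  have h1 := hf.mul (jj_scale_subexp (show -1 < ν + 1 by linarith) hb)
  have h2 := hf.mul (jj_scale_subexp (show -1 < ν + 2 by linarith) hb)
  have h3 := (SubExp.id.mul SubExp.id).mul h2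
  simp only [← pow_two] at h3
  have := lapR_add hp hε h1 h3 (ν + 1) (-(b^2/4))
  rw [lapR_sq] at this
  rw [sub_eq_add_neg, ← neg_mul, ← this]
  congr 1; funext t
  rw [jj_rec hν]; ring

lemma gg_rec {μ a p : ℝ} (ha : 0 < a) (hp : 0 < p) :
    gg μ a p = (μ + 1) * gg (μ + 1) a p - a ^ 2 / 4 * gg (μ + 2) a (p + 2) := by
  have h := rGamma (μ + 1 - p / 2)
  simp only [gg]
  rw [show μ + 1 + 1 - p/2 = μ + 1 - p / 2 + 1 by ring, show μ + 2 + 1 - (p+2)/2 = μ + 1 - p / 2 + 1 by ring,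
    show (p + 2) / 2 = p / 2 + 1 by ring, Real.Gamma_add_one (s := p/2) (by positivity), show p + 2 - 1 = p - 1 + 2 by ring,
    Real.rpow_add two_pos, Real.rpow_two, show -(p+2) = -p + -2 by ring, Real.rpow_add ha, Real.rpow_neg ha.le 2, Real.rpow_two]
  rw [div_eq_mul_one_div _ (Real.Gamma (μ + 1 - p / 2)), ← h]
  field_simp
  ring

lemma lim_base {μ a p : ℝ} (hμ : -1 < μ) (hp : 0 < p) (ha : 0 < a) (h : p < 2 * μ + 1) :
    Tendsto (fun ε => lapR p (fun t => jj μ (a * t)) ε) (nhdsWithin 0 (Set.Ioi 0)) (nhds (gg μ a p)) := by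
  set α := p / 2 with hα
  have hα0 : 0 < α := by positivity
  set β := μ + 1/2 - α with hβ
  have hβ0 : 0 < β := by rw [hβ, hα]; linarith
  have hGβ := Real.Gamma_pos_of_pos hβ0
  have hp2 : p = 2 * α := by rw [hα]; ring
  set K := Real.Gamma (2 * α) / Real.Gamma (α + 1/2)
  have hK : 0 < K := div_pos (Real.Gamma_pos_of_pos (by positivity)) (Real.Gamma_pos_of_pos (by positivity))
  have e1 : ∀ ε > 0, lapR p (fun t => jj μ (a * t)) ε = 1 / Real.Gamma β *
      ∫ v in Set.Ioo (0:ℝ) 1, v ^ (α - 1/2) * (1 - v) ^ (β - 1) * (K * (ε ^ 2 + a ^ 2 * v) ^ (-α)) := by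
    intro ε hε
    have h1 := fubini_jj (κ := α - 1/2) (f := fun _ => 1) (by linarith) hβ0 hp ha.le (.const 1) hε
    rw [show α - 1/2 + β = μ by rw [hβ]; ring] at h1
    simp only [one_mul] at h1
    rw [h1]
    congr 1
    refine setIntegral_congr_fun measurableSet_Ioo fun v hv => ?_
    have hv0 : 0 < v := hv.1
    rw [hp2, base1 hα0 (by positivity) hε, mul_pow, Real.sq_sqrt hv0.le]
  have hb := beta_int (α := 1/2) (β := β) (by norm_num) hβ0
  have e2 : ∀ v ∈ Set.Ioo (0:ℝ) 1, v ^ (α - 1/2) * (1 - v) ^ (β - 1) * (K * (a ^ 2 * v) ^ (-α))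
      = K * a ^ (-p) * (v ^ ((1:ℝ)/2 - 1) * (1 - v) ^ (β - 1)) := by
    intro v hv
    have hv0 : 0 < v := hv.1
    rw [Real.mul_rpow (by positivity) hv0.le, ← Real.rpow_natCast, ← Real.rpow_mul ha.le,
      show (1:ℝ)/2 - 1 = (α - 1/2) + (-α) by ring, Real.rpow_add hv0, hp2]
    push_cast
    rw [show 2 * -α = -(2 * α) by ring]; ring
  have hlim : Tendsto (fun ε : ℝ => ∫ v in Set.Ioo (0:ℝ) 1, v ^ (α - 1/2) * (1 - v) ^ (β - 1) * (K * (ε ^ 2 + a ^ 2 * v) ^ (-α)))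
      (nhdsWithin 0 (Set.Ioi 0)) (nhds (∫ v in Set.Ioo (0:ℝ) 1, K * a ^ (-p) * (v ^ ((1:ℝ)/2 - 1) * (1 - v) ^ (β - 1)))) := by
    refine tendsto_integral_filter_of_dominated_convergence
      (fun v => K * a ^ (-p) * (v ^ ((1:ℝ)/2 - 1) * (1 - v) ^ (β - 1))) ?_ ?_ (hb.1.const_mul _) ?_
    · refine Eventually.of_forall fun ε => Measurable.aestronglyMeasurable ?_
      exact ((measurable_id.pow_const _).mul ((measurable_const.sub measurable_id).pow_const _)).mul
        (measurable_const.mul ((measurable_const.add (measurable_const.mul measurable_id)).pow_const _))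
    · refine Eventually.of_forall fun ε => ?_
      filter_upwards [self_mem_ae_restrict measurableSet_Ioo] with v hv
      rw [← e2 v hv]
      have hv0 : 0 < v := hv.1
      have hv1 : 0 < 1 - v := sub_pos.2 hv.2
      rw [Real.norm_of_nonneg (by positivity)]
      refine mul_le_mul_of_nonneg_left (mul_le_mul_of_nonneg_left ?_ hK.le) (by positivity)
      exact Real.rpow_le_rpow_of_nonpos (by positivity) (by nlinarith [sq_nonneg ε]) (by linarith)
    · filter_upwards [self_mem_ae_restrict measurableSet_Ioo] with v hv
      rw [← e2 v hv]
      have hv0 : 0 < v := hv.1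
      refine Tendsto.mono_left ?_ nhdsWithin_le_nhds
      have : ContinuousAt (fun ε : ℝ => v ^ (α - 1/2) * (1 - v) ^ (β - 1) * (K * (ε ^ 2 + a ^ 2 * v) ^ (-α))) 0 := by
        refine continuousAt_const.mul (continuousAt_const.mul (ContinuousAt.rpow_const (by fun_prop) (Or.inl ?_)))
        positivity
      have h2 := this.tendsto
      simpa using h2
  rw [integral_const_mul, hb.2] at hlim
  have h3 := hlim.const_mul (1 / Real.Gamma β)
  refine (h3.congr' ?_).trans (le_of_eq ?_)
  · filter_upwards [self_mem_nhdsWithin] with ε hε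
    exact (e1 ε hε).symm
  · congr 1
    have hd := Real.Gamma_mul_Gamma_add_half α
    have hg1 : 0 < Real.Gamma (α + 1/2) := Real.Gamma_pos_of_pos (by positivity)
    have e4 : (2:ℝ) ^ (1 - 2 * α) = 1 / 2 ^ (2 * α - 1) := by
      rw [show 1 - 2 * α = -(2 * α - 1) by ring, Real.rpow_neg two_pos.le, one_div]
    rw [e4] at hd
    have hpi : 0 < √π := Real.sqrt_pos.2 Real.pi_pos
    simp only [gg, K]
    rw [show 1/2 + β = μ + 1 - p/2 by rw [hβ, hα]; ring, ← hα, hp2, Real.Gamma_one_half_eq]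
    have hg2 : 0 < Real.Gamma (μ + 1 - 2 * α / 2) := Real.Gamma_pos_of_pos (by linarith)
    field_simp at hd ⊢
    linear_combination -(Real.Gamma (μ + 1 - α))⁻¹ * hd

lemma lim_jj {μ a p : ℝ} (hμ : -1 < μ) (hp : 0 < p) (ha : 0 < a) :
    Tendsto (fun ε => lapR p (fun t => jj μ (a * t)) ε) (nhdsWithin 0 (Set.Ioi 0)) (nhds (gg μ a p)) := by
  have main : ∀ n : ℕ, ∀ μ p : ℝ, -1 < μ → 0 < p → p - (2 * μ + 1) < n →
      Tendsto (fun ε => lapR p (fun t => jj μ (a * t)) ε) (nhdsWithin 0 (Set.Ioi 0)) (nhds (gg μ a p)) := by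
    intro n
    induction n with
    | zero => 
      intro μ p hμ hp h
      exact lim_base hμ hp ha (by push_cast at h; linarith)
    | succ n ih =>
      intro μ p hμ hp h
      push_cast at h
      have h1 := ih (μ + 1) p (by linarith) hp (by linarith)
      have h2 := ih (μ + 2) (p + 2) (by linarith) (by linarith) (by linarith)
      rw [gg_rec ha hp]
      refine ((h1.const_mul (μ + 1)).sub (h2.const_mul (a^2/4))).congr' ?_
      filter_upwards [self_mem_nhdsWithin] with ε hε
      have := lapR_rec hp hε (.const 1) hμ ha.le
      simp only [one_mul] at this
      exact this.symm
  obtain ⟨n, hn⟩ := exists_nat_gt (p - (2 * μ + 1))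
  exact main n μ p hμ hp hn

lemma gg_succ {μ a p : ℝ} (ha : 0 < a) (hp : 0 < p) :
    gg μ a (p + 2) = p * (2 * μ - p) / a ^ 2 * gg μ a p := by
  have h := rGamma (μ - p / 2)
  simp only [gg]
  rw [show μ + 1 - (p+2)/2 = μ - p / 2 by ring, show μ + 1 - p / 2 = μ - p / 2 + 1 by ring,
    show (p + 2) / 2 = p / 2 + 1 by ring, Real.Gamma_add_one (s := p / 2) (by positivity), show p + 2 - 1 = p - 1 + 2 by ring,
    Real.rpow_add two_pos, Real.rpow_two, show -(p+2) = -p + -2 by ring, Real.rpow_add ha, Real.rpow_neg ha.le 2, Real.rpow_two]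
  rw [div_eq_mul_one_div _ (Real.Gamma (μ - p / 2)), ← h]
  field_simp

lemma gg_even_summable {μ a q x : ℝ} (hq : 0 < q) (ha : 0 < a) (hx : 0 ≤ x) (hxa : x < a) :
    Summable fun r : ℕ => x ^ (2 * r) / (Nat.factorial (2 * r)) * |gg μ a (q + 2 * r)| := by
  obtain ⟨ρ, hρ1, hρ2⟩ := exists_between (show x ^ 2 / a ^ 2 < 1 by
    rw [div_lt_one (by positivity)]; exact pow_lt_pow_left₀ hxa hx two_ne_zero)
  have t1 := (tend_lin (q/2) 1 (1/2)).mul ((tend_lin (μ - q/2) (-1) 1).mul_const (x^2/a^2))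
  have t2 := t1.abs
  have hl : |1 * (-1 * (x^2/a^2))| < ρ := by
    rw [one_mul, neg_one_mul, abs_neg, abs_of_nonneg (by positivity)]; exact hρ1
  refine summable_of_ratio_norm_eventually_le hρ2 ?_
  filter_upwards [t2.eventually (eventually_lt_nhds hl)] with r hr
  have hr0 : (0:ℝ) ≤ r := Nat.cast_nonneg r
  rw [show q + 2 * ((r + 1 : ℕ):ℝ) = q + 2 * r + 2 by push_cast; ring, gg_succ ha (by positivity),
    show 2 * (r+1) = 2 * r + 1 + 1 by ring, Nat.factorial_succ, Nat.factorial_succ, pow_succ, pow_succ]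
  push_cast
  rw [abs_mul, Real.norm_of_nonneg (by positivity), Real.norm_of_nonneg (by positivity)]
  refine le_trans (le_of_eq ?_) (mul_le_mul_of_nonneg_right hr.le (by positivity))
  have e : |(q / 2 + 1 * (r:ℝ)) / (1 / 2 + r) * ((μ - q / 2 + -1 * r) / (1 + r) * (x ^ 2 / a ^ 2))|
     = |(q + 2 * r) * (2 * μ - (q + 2 * r)) / a ^ 2| * (x ^ 2 / ((2 * r + 1) * (2 * r + 1 + 1))) := by
    rw [show (q / 2 + 1 * (r:ℝ)) / (1 / 2 + r) * ((μ - q / 2 + -1 * r) / (1 + r) * (x ^ 2 / a ^ 2))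
      = ((q + 2 * r) * (2 * μ - (q + 2 * r)) / a ^ 2) * (x ^ 2 / ((2 * r + 1) * (2 * r + 1 + 1))) by
        field_simp; ring, abs_mul, abs_of_nonneg (show 0 ≤ (x ^ 2 / ((2 * (r:ℝ) + 1) * (2 * r + 1 + 1))) by positivity)]
  rw [e]
  field_simp

lemma gg_summable {μ a p x : ℝ} (hp : 0 < p) (ha : 0 < a) (hx : 0 ≤ x) (hxa : x < a) :
    Summable fun m : ℕ => x ^ m / (Nat.factorial m) * |gg μ a (p + m)| := by
  have h1 := gg_even_summable (μ := μ) hp ha hx hxa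
  have h2 := (gg_even_summable (μ := μ) (show 0 < p + 1 by linarith) ha hx hxa).mul_left x
  have h3 : Summable fun r : ℕ => x ^ (2 * r + 1) / (Nat.factorial (2 * r + 1)) * |gg μ a (p + (2 * r + 1 : ℕ))| := by
    refine Summable.of_nonneg_of_le (fun r => by positivity) (fun r => ?_) h2
    rw [show p + ((2 * r + 1 : ℕ):ℝ) = p + 1 + 2 * r by push_cast; ring, ← mul_assoc]
    refine mul_le_mul_of_nonneg_right ?_ (abs_nonneg _)
    rw [pow_succ, mul_comm, ← mul_div_assoc]
    refine div_le_div_of_nonneg_left (by positivity) (by positivity) ?_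
    exact_mod_cast Nat.factorial_le (by omega)
  have h4 : Summable fun r : ℕ => x ^ (2 * r) / (Nat.factorial (2 * r)) * |gg μ a (p + (2 * r : ℕ))| := by
    simpa using h1
  exact (HasSum.even_add_odd (f := fun m : ℕ => x ^ m / (Nat.factorial m) * |gg μ a (p + m)|) h4.hasSum h3.hasSum).summable

noncomputable def hT (μ a p : ℝ) (m : ℕ) (z : ℂ) : ℂ := (-z) ^ m / (Nat.factorial m) * (gg μ a (p + m) : ℝ)

noncomputable def hh (μ a p : ℝ) (z : ℂ) : ℂ := ∑' m : ℕ, hT μ a p m z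

lemma hT_norm (μ a p : ℝ) (m : ℕ) (z : ℂ) : ‖hT μ a p m z‖ = ‖z‖ ^ m / (Nat.factorial m) * |gg μ a (p + m)| := by
  simp [hT]

lemma hT_summable {μ a p : ℝ} {z : ℂ} (hp : 0 < p) (ha : 0 < a) (hz : ‖z‖ < a) :
    Summable fun m => hT μ a p m z := by
  refine Summable.of_norm ?_
  simp only [hT_norm]
  exact gg_summable hp ha (norm_nonneg _) hz

lemma hT_hasSum {μ a p : ℝ} {z : ℂ} (hp : 0 < p) (ha : 0 < a) (hz : ‖z‖ < a) :
    HasSum (fun m => hT μ a p m z) (hh μ a p z) := (hT_summable hp ha hz).hasSum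

lemma hh_zero (μ a p : ℝ) : hh μ a p 0 = gg μ a p := by
  rw [hh, tsum_eq_single 0]
  · simp [hT]
  · intro m hm
    simp [hT, hm]

lemma hh_bound {μ a p ρ : ℝ} (hp : 0 < p) (ha : 0 < a) (hρ : 0 ≤ ρ) (hρa : ρ < a) :
    ∃ C : ℝ, ∀ z : ℂ, ‖z‖ ≤ ρ → ‖hh μ a p z‖ ≤ C := by
  have hs := gg_summable (μ := μ) hp ha hρ hρa
  refine ⟨_, fun z hz => tsum_of_norm_bounded hs.hasSum fun m => ?_⟩
  rw [hT_norm]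
  gcongr

lemma hh_deriv {μ a p : ℝ} {z : ℂ} (hp : 0 < p) (ha : 0 < a) (hz : ‖z‖ < a) :
    HasDerivAt (hh μ a p) (-(hh μ a (p+1) z)) z := by
  obtain ⟨ρ, hρ1, hρ2⟩ := exists_between hz
  have hρ0 : 0 < ρ := (norm_nonneg z).trans_lt hρ1
  have hs := gg_summable (μ := μ) (show 0 < p + 1 by linarith) ha hρ0.le hρ2
  let u : ℕ → ℝ := fun n => Nat.casesOn n 0 fun m => ρ ^ m / (Nat.factorial m) * |gg μ a (p + 1 + m)|
  let g' : ℕ → ℂ → ℂ := fun n w => Nat.casesOn n 0 fun m => -hT μ a (p+1) m w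
  have hu : Summable u := (summable_nat_add_iff 1).1 hs
  have key := hasDerivAt_tsum_of_isPreconnected (u := u) (g := fun m w => hT μ a p m w) (g' := g')
    (t := Metric.ball (0:ℂ) ρ) (y₀ := 0) (y := z) hu Metric.isOpen_ball (convex_ball _ _).isPreconnected ?_ ?_
    (by simpa using hρ0) (hT_summable hp ha (by simpa using ha)) (by simpa using hρ1)
  · have e : ∑' n, g' n z = -(hh μ a (p+1) z) := by
      have h1 : HasSum (fun n => g' (n+1) z) (-(hh μ a (p+1) z)) := (hT_hasSum (by linarith) ha hz).neg
      have h2 := (hasSum_nat_add_iff (f := fun n => g' n z) 1).1 h1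
      rw [h2.tsum_eq]; simp [g']
    rw [e] at key
    exact key
  · intro n y hy
    cases n with
    | zero => 
      simp only [hT, g', pow_zero]
      exact hasDerivAt_const _ _
    | succ m =>
      simp only [hT, g']
      have h1 := (((hasDerivAt_id y).neg.pow (m+1)).div_const ((Nat.factorial (m+1) : ℕ) : ℂ)).mul_const ((gg μ a (p + (m+1:ℕ)) : ℝ) : ℂ)
      refine h1.congr_deriv ?_
      rw [show p + 1 + (m:ℝ) = p + (m+1:ℕ) by push_cast; ring, Nat.factorial_succ]
      have : (m:ℂ) + 1 ≠ 0 := by exact_mod_cast Nat.succ_ne_zero m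
      simp
      field_simp
  · intro n y hy
    have hy' : ‖y‖ < ρ := by simpa using hy
    cases n with
    | zero => simp [g', u]
    | succ m =>
      simp only [g', u, norm_neg, hT_norm]
      gcongr

lemma hh_ode {μ a p : ℝ} {z : ℂ} (hp : 0 < p) (ha : 0 < a) (hz : ‖z‖ < a) :
    (z ^ 2 + (a:ℂ) ^ 2) * hh μ a (p+2) z
      - (2 * (p - μ) + 1) * z * hh μ a (p+1) z
      + p * (p - 2 * μ) * hh μ a p z = 0 := by
  have h0 := hT_hasSum (μ := μ) hp ha hz
  have h1 := hT_hasSum (μ := μ) (show 0 < p + 1 by linarith) ha hz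
  have h2 := hT_hasSum (μ := μ) (show 0 < p + 2 by linarith) ha hz
  have k1 : HasSum (fun m : ℕ => (m:ℂ) * hT μ a p m z) (-z * hh μ a (p+1) z) := by
    rw [← hasSum_nat_add_iff' 1]
    simp only [Finset.range_one, Finset.sum_singleton, Nat.cast_zero, zero_mul, sub_zero]
    refine (h1.mul_left (-z)).congr_fun fun m => ?_
    simp only [hT]
    rw [show p + 1 + (m:ℝ) = p + (m+1:ℕ) by push_cast; ring, Nat.factorial_succ]
    have : (m:ℂ) + 1 ≠ 0 := by exact_mod_cast Nat.succ_ne_zero m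
    push_cast
    rw [pow_succ]
    field_simp
  have k2 : HasSum (fun m : ℕ => (m:ℂ) * (m - 1) * hT μ a p m z) (z^2 * hh μ a (p+2) z) := by
    rw [← hasSum_nat_add_iff' 2]
    simp only [Finset.sum_range_succ, Finset.range_zero, Finset.sum_empty, Nat.cast_zero, zero_mul, sub_zero, Nat.cast_one, sub_self, mul_zero, add_zero]
    refine (h2.mul_left (z^2)).congr_fun fun m => ?_
    simp only [hT]
    rw [show p + 2 + (m:ℝ) = p + (m+2:ℕ) by push_cast; ring, Nat.factorial_succ, Nat.factorial_succ]
    have h3 : (m:ℂ) + 1 ≠ 0 := by exact_mod_cast Nat.succ_ne_zero m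
    have h4 : (m:ℂ) + 1 + 1 ≠ 0 := by exact_mod_cast Nat.succ_ne_zero (m+1)
    push_cast
    field_simp
    ring
  have k3 := ((k2.add (h2.mul_left ((a:ℂ)^2))).add (k1.mul_left (2 * (p - μ) + 1 : ℂ))).add (h0.mul_left (p * (p - 2 * μ) : ℂ))
  have k4 : HasSum (fun _ : ℕ => (0:ℂ)) 0 := hasSum_zero
  have k5 := k3.unique (k4.congr_fun fun m => ?_)
  · rw [← k5]; ring
  · simp only [hT]
    rw [show p + 2 + (m:ℝ) = p + m + 2 by ring, gg_succ ha (by positivity)]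
    have : (a:ℂ) ≠ 0 := by exact_mod_cast ha.ne'
    push_cast
    field_simp
    ring

lemma lap_eq_hh_real {μ a p x : ℝ} (hμ : -1 < μ) (hp : 0 < p) (ha : 0 < a) (hx : 0 < x) (hxa : x < a) :
    lap p (fun t => jj μ (a * t)) x = hh μ a p x := by
  have hf := jj_scale_subexp hμ ha.le
  set φ : ℝ → ℝ := fun t => jj μ (a * t) with hφ
  have hp1 : 0 < p + 1 := by linarith
  have hp2 : 0 < p + 2 := by linarith
  let u : ℝ → ℝ → ℂ := fun q s => lap q φ s - hh μ a q s
  have hn : ∀ s : ℝ, 0 < s → s < a → ‖(s:ℂ)‖ < a := fun s h1 h2 => by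
    rw [Complex.norm_real, Real.norm_of_nonneg h1.le]; exact h2
  have du : ∀ q : ℝ, 0 < q → ∀ s : ℝ, 0 < s → s < a → HasDerivAt (u q) (-(u (q+1) s)) s := by
    intro q hq s h1 h2
    have d1 := (lap_deriv hq hf (z := s) (by simpa using h1)).comp_ofReal
    have d2 := (hh_deriv (μ := μ) hq ha (hn s h1 h2)).comp_ofReal
    refine (d1.sub d2).congr_deriv ?_
    simp only [u]; ring
  have hode : ∀ s : ℝ, 0 < s → s < a → ((s:ℂ) ^ 2 + (a:ℂ) ^ 2) * u (p+2) s
      = (2 * (p - μ) + 1) * s * u (p+1) s - p * (p - 2 * μ) * u p s := by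
    intro s h1 h2
    have o1 := ode_complex hμ hp ha (z := s) (by simpa using h1)
    have o2 := hh_ode (μ := μ) hp ha (hn s h1 h2)
    simp only [u]
    linear_combination o1 - o2
  set A : ℝ := |2 * (p - μ) + 1| * a with hA
  set B : ℝ := |p * (p - 2 * μ)| with hB
  set K : ℝ := 1 + (A + B) / a ^ 2 with hK
  let f : ℝ → ℂ × ℂ := fun s => (u p s, u (p+1) s)
  let f' : ℝ → ℂ × ℂ := fun s => (-(u (p+1) s), -(u (p+2) s))
  have df : ∀ s : ℝ, 0 < s → s < a → HasDerivAt f (f' s) s := by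
    intro s h1 h2
    have d1 := du p hp s h1 h2
    have d2 := du (p+1) hp1 s h1 h2
    rw [show p + 1 + 1 = p + 2 by ring] at d2
    exact d1.prodMk d2
  have bf : ∀ s : ℝ, 0 < s → s < a → ‖f' s‖ ≤ K * ‖f s‖ + 0 := by
    intro s h1 h2
    have n0 : ‖u p s‖ ≤ ‖f s‖ := norm_fst_le (f s)
    have n1 : ‖u (p+1) s‖ ≤ ‖f s‖ := norm_snd_le (f s)
    have hA0 : 0 ≤ A := by positivity
    have hB0 : 0 ≤ B := by positivity
    have n2 : ‖u (p+2) s‖ ≤ (A + B) / a ^ 2 * ‖f s‖ := by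
      have e : (s^2 + a^2) * ‖u (p+2) s‖ ≤ A * ‖u (p+1) s‖ + B * ‖u p s‖ := by
        have e1 := congrArg norm (hode s h1 h2)
        rw [norm_mul] at e1
        have e2 : ‖(s:ℂ)^2 + (a:ℂ)^2‖ = s^2 + a^2 := by
          rw [show (s:ℂ)^2 + (a:ℂ)^2 = ((s^2 + a^2 : ℝ) : ℂ) by push_cast; ring, Complex.norm_real, Real.norm_of_nonneg (by positivity)]
        rw [← e2, e1]
        refine (norm_sub_le _ _).trans ?_
        have e3 : ‖(2 * ((p:ℂ) - μ) + 1) * s * u (p+1) s‖ ≤ A * ‖u (p+1) s‖ := by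
          rw [show (2 * ((p:ℂ) - μ) + 1) * s = (((2 * (p - μ) + 1) * s : ℝ) : ℂ) by push_cast; ring, norm_mul, Complex.norm_real, Real.norm_eq_abs, abs_mul, abs_of_pos h1, hA]
          gcongr
        have e4 : ‖(p:ℂ) * (p - 2 * μ) * u p s‖ = B * ‖u p s‖ := by
          rw [show (p:ℂ) * (p - 2 * μ) = ((p * (p - 2 * μ) : ℝ) : ℂ) by push_cast; ring, norm_mul, Complex.norm_real, Real.norm_eq_abs]
        rw [e4]; linarith
      rw [div_mul_eq_mul_div, le_div_iff₀ (by positivity)]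
      have e5 : 0 ≤ s^2 * ‖u (p+2) s‖ := by positivity
      have e6 := mul_le_mul_of_nonneg_left n0 hB0
      have e7 := mul_le_mul_of_nonneg_left n1 hA0
      linarith
    have hq : 0 ≤ (A + B) / a^2 * ‖f s‖ := by positivity
    rw [add_zero, hK, add_mul, one_mul, Prod.norm_def]
    refine max_le ?_ ?_
    · simp only [f', norm_neg]; linarith
    · simp only [f', norm_neg]; linarith [norm_nonneg (f s)]
  have hK0 : 0 ≤ K := by positivity
  have gron : ∀ s : ℝ, 0 < s → s < x → ‖f x‖ ≤ ‖f s‖ * Real.exp (K * x) := by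
    intro s h1 h2
    have := norm_le_gronwallBound_of_norm_deriv_right_le (f := f) (f' := f') (δ := ‖f s‖) (K := K) (ε := 0) (a := s) (b := x)
      (fun y hy => (df y (h1.trans_le hy.1) (hy.2.trans_lt hxa)).continuousAt.continuousWithinAt)
      (fun y hy => (df y (h1.trans_le hy.1) (hy.2.trans hxa)).hasDerivWithinAt) le_rfl
      (fun y hy => bf y (h1.trans_le hy.1) (hy.2.trans hxa)) x ⟨h2.le, le_rfl⟩
    rw [gronwallBound_ε0] at this
    refine this.trans ?_
    gcongr
    linarith
  have lu : ∀ q : ℝ, 0 < q → Tendsto (u q) (nhdsWithin 0 (Set.Ioi 0)) (nhds 0) := by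
    intro q hq
    have l1 := (Complex.continuous_ofReal.tendsto _).comp (lim_jj hμ hq ha)
    have l2 : Tendsto (fun s : ℝ => hh μ a q s) (nhdsWithin 0 (Set.Ioi 0)) (nhds (gg μ a q : ℂ)) := by
      have c1 : ContinuousAt (hh μ a q) ((0:ℝ):ℂ) := (hh_deriv hq ha (by simpa using ha)).continuousAt
      have c2 : ContinuousAt (fun s : ℝ => hh μ a q s) 0 := c1.comp Complex.continuous_ofReal.continuousAt
      have c3 := c2.tendsto
      simp only [Complex.ofReal_zero, hh_zero] at c3
      exact c3.mono_left nhdsWithin_le_nhds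
    have l3 := l1.sub l2
    rw [sub_self] at l3
    refine l3.congr fun s => ?_
    simp only [u, Function.comp, lap_ofReal, hφ]
  have lf : Tendsto (fun s => ‖f s‖ * Real.exp (K * x)) (nhdsWithin 0 (Set.Ioi 0)) (nhds 0) := by
    have := ((lu p hp).prodMk_nhds (lu (p+1) hp1)).norm.mul_const (Real.exp (K * x))
    simpa [f, Prod.norm_def] using this
  have h0 : ‖f x‖ ≤ 0 := by
    refine ge_of_tendsto lf ?_
    filter_upwards [Ioo_mem_nhdsGT hx] with s hs
    exact gron s hs.1 hs.2
  have h1 : ‖u p x‖ ≤ 0 := (norm_fst_le (f x)).trans h0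
  exact sub_eq_zero.1 (norm_le_zero_iff.1 h1)

lemma lap_eq_hh {μ a p : ℝ} {z : ℂ} (hμ : -1 < μ) (hp : 0 < p) (ha : 0 < a) (hz : 0 < z.re) (hza : ‖z‖ < a) :
    lap p (fun t => jj μ (a * t)) z = hh μ a p z := by
  have hU : IsOpen ({z : ℂ | 0 < z.re} ∩ Metric.ball 0 a) := isOpen_rhp.inter Metric.isOpen_ball
  refine ident hU (convex_rhp.inter (convex_ball _ _)).isPreconnected
    ((lap_diffOn hp (jj_scale_subexp hμ ha.le)).mono Set.inter_subset_left)
    (fun w hw => (hh_deriv hp ha (by simpa using hw.2)).differentiableAt.differentiableWithinAt) ha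
    (fun x h1 h2 => ⟨by simpa using h1, by simpa [abs_of_pos h1] using h2⟩)
    (fun x h1 h2 => lap_eq_hh_real hμ hp ha h1 h2) ⟨hz, by simpa using hza⟩

lemma Gamma_half_nat (r : ℕ) : Real.Gamma (1/2 + r) = Nat.factorial (2 * r) / (4 ^ r * Nat.factorial r) * √π := by
  induction r with
  | zero => 
    rw [show (1/2 + ((0:ℕ):ℝ)) = 1/2 by norm_num, Real.Gamma_one_half_eq]; simp
  | succ n ih =>
    rw [show (1/2 + ((n+1 : ℕ):ℝ)) = (1/2 + (n:ℝ)) + 1 by push_cast; ring, Real.Gamma_add_one (by positivity), ih]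
    rw [show 2 * (n + 1) = 2 * n + 1 + 1 by ring, Nat.factorial_succ, Nat.factorial_succ, Nat.factorial_succ]
    push_cast
    field_simp
    ring

lemma hh_re {μ a p y : ℝ} (hp : 0 < p) (ha : 0 < a) (hy0 : 0 ≤ y) (hy : y < a) :
    HasSum (fun r : ℕ => (-1) ^ r * y ^ (2 * r) / (Nat.factorial (2 * r)) * gg μ a (p + 2 * r)) (hh μ a p (y * Complex.I)).re := by
  have h := Complex.hasSum_re (hT_hasSum (μ := μ) (z := y * Complex.I) hp ha (by simpa [abs_of_nonneg hy0] using hy))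
  have hinj : Function.Injective (fun r : ℕ => 2 * r) := fun r s h => by simpa using h
  have hterm : ∀ r : ℕ, (-((y:ℂ) * Complex.I)) ^ (2 * r) = (((-1) ^ r * y ^ (2 * r) : ℝ) : ℂ) := by
    intro r
    rw [pow_mul, neg_sq, mul_pow, Complex.I_sq, pow_mul y]
    push_cast
    rw [← mul_pow]; ring
  rw [← hinj.hasSum_iff] at h
  · refine h.congr_fun fun r => ?_
    simp only [Function.comp, hT]
    rw [hterm]
    have : ((((-1) ^ r * y ^ (2 * r) : ℝ) : ℂ) / (Nat.factorial (2 * r)) * ((gg μ a (p + (2 * r : ℕ)) : ℝ) : ℂ))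
      = (((-1) ^ r * y ^ (2 * r) / (Nat.factorial (2 * r)) * gg μ a (p + (2 * r : ℕ)) : ℝ) : ℂ) := by push_cast; ring
    rw [this, Complex.ofReal_re]; push_cast; ring
  · intro m hm
    obtain ⟨k, rfl | rfl⟩ := m.even_or_odd'
    · exact absurd ⟨k, rfl⟩ hm
    · simp only [hT]
      rw [pow_succ, hterm]
      have : ((((-1) ^ k * y ^ (2 * k) : ℝ) : ℂ) * (-(y * Complex.I)) / (Nat.factorial (2 * k + 1)) * ((gg μ a (p + (2 * k + 1 : ℕ)) : ℝ) : ℂ))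
        = (((-1) ^ k * y ^ (2 * k) * (-y) / (Nat.factorial (2 * k + 1)) * gg μ a (p + (2 * k + 1 : ℕ)) : ℝ) : ℂ) * Complex.I := by
          push_cast; ring
      rw [this, Complex.re_ofReal_mul]; simp

def MainClaim (μ ν a b p : ℝ) : Prop :=
  ∃ L : ℝ, HasSum (fun r : ℕ => jc ν r * b ^ (2 * r) * gg μ a (p + 2 * r)) L ∧
    Tendsto (fun ε => lapR p (fun t => jj μ (a * t) * jj ν (b * t)) ε) (nhdsWithin 0 (Set.Ioi 0)) (nhds L)

lemma main_base {μ ν a b p : ℝ} (hμ : -1 < μ) (hν : -1/2 < ν) (hp : 0 < p) (hb : 0 < b) (hba : b < a) :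
    MainClaim μ ν a b p := by
  have ha : 0 < a := hb.trans hba
  have hβ : 0 < ν + 1/2 := by linarith
  have hGβ := Real.Gamma_pos_of_pos hβ
  have hpi : 0 < √π := Real.sqrt_pos.2 Real.pi_pos
  have hf := jj_scale_subexp hμ ha.le
  obtain ⟨ρ, hρ1, hρ2⟩ := exists_between hba
  have hρ0 : 0 < ρ := hb.trans hρ1
  obtain ⟨C, hC⟩ := hh_bound (μ := μ) hp ha hρ0.le hρ2
  have hnorm : ∀ ε v : ℝ, 0 ≤ ε → ε < ρ - b → v ∈ Set.Ioo (0:ℝ) 1 → ‖(ε:ℂ) + (b * √v : ℝ) * Complex.I‖ ≤ ρ := by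
    intro ε v h1 h2 hv
    have hs : √v ≤ 1 := Real.sqrt_le_one.2 hv.2.le
    refine (norm_add_le _ _).trans ?_
    rw [norm_mul, Complex.norm_I, mul_one, Complex.norm_real, Complex.norm_real, Real.norm_of_nonneg h1, Real.norm_of_nonneg (by positivity)]
    nlinarith
  have hw := beta_int (α := 1/2) (β := ν + 1/2) (by norm_num) hβ
  let F : ℝ → ℝ → ℝ := fun ε v => v ^ ((1:ℝ)/2 - 1) * (1 - v) ^ (ν + 1/2 - 1) * (hh μ a p (ε + (b * √v : ℝ) * Complex.I)).re
  have e1 : ∀ ε : ℝ, 0 < ε → ε < ρ - b → lapR p (fun t => jj μ (a * t) * jj ν (b * t)) ε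
      = 1 / Real.Gamma (ν + 1/2) * (1 / √π) * ∫ v in Set.Ioo (0:ℝ) 1, F ε v := by
    intro ε h1 h2
    have h3 := fubini_jj (κ := -1/2) (by norm_num) hβ hp hb.le hf h1
    rw [show -1/2 + (ν + 1/2) = ν by ring] at h3
    rw [h3, mul_assoc, ← integral_const_mul (1 / √π)]
    congr 1
    refine setIntegral_congr_fun measurableSet_Ioo fun v hv => ?_
    have h4 := lap_re hp hf h1 (b * √v)
    rw [lap_eq_hh hμ hp ha (by simpa using h1) (lt_of_le_of_lt (hnorm ε v h1.le h2 hv) hρ2)] at h4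
    simp only [F]
    rw [h4]
    have h5 : lapR p (fun t => jj μ (a * t) * jj (-1/2) (b * √v * t)) ε
      = 1 / √π * lapR p (fun t => jj μ (a * t) * Real.cos (b * √v * t)) ε := by
      rw [lapR, lapR, ← integral_const_mul]
      congr 1; funext t
      rw [jj_neg_half]; ring
    rw [h5, show (1:ℝ)/2 - 1 = -1/2 by norm_num]; ring
  have hlim : Tendsto (fun ε : ℝ => ∫ v in Set.Ioo (0:ℝ) 1, F ε v) (nhdsWithin 0 (Set.Ioi 0))
      (nhds (∫ v in Set.Ioo (0:ℝ) 1, F 0 v)) := by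
    have hev : ∀ᶠ ε : ℝ in nhdsWithin 0 (Set.Ioi 0), ε ∈ Set.Ioo 0 (ρ - b) := Ioo_mem_nhdsGT (by linarith)
    refine tendsto_integral_filter_of_dominated_convergence
      (fun v => (v ^ ((1:ℝ)/2 - 1) * (1 - v) ^ (ν + 1/2 - 1)) * C) ?_ ?_ (hw.1.mul_const _) ?_
    · filter_upwards [hev] with ε hε
      refine ContinuousOn.aestronglyMeasurable ?_ measurableSet_Ioo
      intro v hv
      have hc : ContinuousAt (hh μ a p) (ε + (b * √v : ℝ) * Complex.I) :=
        (hh_deriv hp ha ((hnorm ε v hε.1.le hε.2 hv).trans_lt hρ2)).continuousAt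
      have hc2 : ContinuousAt (fun v : ℝ => hh μ a p (ε + (b * √v : ℝ) * Complex.I)) v :=
        ContinuousAt.comp (f := fun v : ℝ => (ε : ℂ) + (b * √v : ℝ) * Complex.I) hc (by fun_prop)
      refine ContinuousAt.continuousWithinAt ?_
      refine ContinuousAt.mul (ContinuousAt.mul ?_ ?_) (Complex.continuous_re.continuousAt.comp hc2)
      · exact continuousAt_id.rpow_const (Or.inl hv.1.ne')
      · exact (continuousAt_const.sub continuousAt_id).rpow_const (Or.inl (sub_pos.2 hv.2).ne')
    · filter_upwards [hev] with ε hε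
      filter_upwards [self_mem_ae_restrict measurableSet_Ioo] with v hv
      have hv0 : 0 < v := hv.1
      have hv1 : 0 < 1 - v := sub_pos.2 hv.2
      simp only [F]
      rw [norm_mul, Real.norm_of_nonneg (by positivity)]
      gcongr
      exact (Complex.abs_re_le_norm _).trans (hC _ (hnorm ε v hε.1.le hε.2 hv))
    · filter_upwards [self_mem_ae_restrict measurableSet_Ioo] with v hv
      refine Tendsto.mono_left ?_ nhdsWithin_le_nhds
      have hc : ContinuousAt (hh μ a p) ((0:ℝ) + (b * √v : ℝ) * Complex.I) :=
        (hh_deriv hp ha ((hnorm 0 v le_rfl (by linarith) hv).trans_lt hρ2)).continuousAt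
      have hc2 : ContinuousAt (fun ε : ℝ => hh μ a p (ε + (b * √v : ℝ) * Complex.I)) 0 :=
        ContinuousAt.comp (f := fun ε : ℝ => (ε : ℂ) + (b * √v : ℝ) * Complex.I) hc (by fun_prop)
      exact (continuousAt_const.mul (Complex.continuous_re.continuousAt.comp hc2)).tendsto
  let c : ℕ → ℝ := fun r => (-1) ^ r * b ^ (2 * r) / (Nat.factorial (2 * r)) * gg μ a (p + 2 * r)
  have hcs : Summable fun r => |c r| := by
    refine (gg_even_summable (μ := μ) hp ha hb.le hba).congr fun r => ?_
    simp only [c]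
    rw [abs_mul, abs_div, abs_mul, abs_pow, abs_neg, abs_one, one_pow, one_mul, abs_of_pos (pow_pos hb _), Nat.abs_cast]
  have hm := beta_moment (α := 1/2) (β := ν + 1/2) (by norm_num) hβ hcs
  have e2 : ∫ v in Set.Ioo (0:ℝ) 1, v ^ ((1:ℝ)/2 - 1) * (1 - v) ^ (ν + 1/2 - 1) * ∑' r, c r * v ^ r
      = ∫ v in Set.Ioo (0:ℝ) 1, F 0 v := by
    refine setIntegral_congr_fun measurableSet_Ioo fun v hv => ?_
    have hs : √v ≤ 1 := Real.sqrt_le_one.2 hv.2.le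
    have hs0 := Real.sqrt_nonneg v
    have h1 := hh_re (μ := μ) (y := b * √v) hp ha (by positivity) (by nlinarith)
    simp only [F, Complex.ofReal_zero, zero_add]
    rw [← h1.tsum_eq]
    congr 2; funext r
    simp only [c]
    rw [mul_pow, pow_mul (√v), Real.sq_sqrt hv.1.le]; ring
  rw [e2] at hm
  refine ⟨1 / Real.Gamma (ν + 1/2) * (1 / √π) * ∫ v in Set.Ioo (0:ℝ) 1, F 0 v, ?_, ?_⟩
  · refine (hm.mul_left _).congr_fun fun r => ?_
    simp only [c, jc]
    rw [Gamma_half_nat, show 1/2 + (ν + 1/2) + (r:ℝ) = ν + r + 1 by ring]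
    have : 0 < Real.Gamma (ν + r + 1) := Real.Gamma_pos_of_pos (by
      have : (0:ℝ) ≤ r := Nat.cast_nonneg r
      linarith)
    generalize Real.Gamma (ν + 1/2) = G at hGβ
    generalize Real.Gamma (ν + r + 1) = H at this
    field_simp
  · refine (hlim.const_mul _).congr' ?_
    filter_upwards [Ioo_mem_nhdsGT (show 0 < ρ - b by linarith)] with ε hε
    exact (e1 ε hε.1 hε.2).symm

lemma jc_rec {ν : ℝ} (hν : -1 < ν) (r : ℕ) :
    jc ν (r+1) = (ν + 1) * jc (ν + 1) (r+1) - 1/4 * jc (ν + 2) r := by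
  have hr : (0:ℝ) ≤ r := Nat.cast_nonneg r
  have h0 : 0 < ν + r + 1 + 1 := by linarith
  have hG := Real.Gamma_pos_of_pos h0
  simp only [jc]
  rw [show ν + 1 + ((r+1:ℕ):ℝ) + 1 = ν + r + 1 + 1 + 1 by push_cast; ring,
    show ν + 2 + (r:ℝ) + 1 = ν + r + 1 + 1 + 1 by ring,
    show ν + ((r+1:ℕ):ℝ) + 1 = ν + r + 1 + 1 by push_cast; ring, Real.Gamma_add_one h0.ne', Nat.factorial_succ]
  push_cast
  field_simp
  ring

lemma main_all {μ ν a b p : ℝ} (hμ : -1 < μ) (hν : -1 < ν) (hp : 0 < p) (hb : 0 < b) (hba : b < a) :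
    MainClaim μ ν a b p := by
  have ha : 0 < a := hb.trans hba
  obtain ⟨L1, s1, t1⟩ := main_base hμ (show -1/2 < ν + 1 by linarith) hp hb hba
  obtain ⟨L2, s2, t2⟩ := main_base hμ (show -1/2 < ν + 2 by linarith) (show 0 < p + 2 by linarith) hb hba
  refine ⟨(ν + 1) * L1 - b^2/4 * L2, ?_, ?_⟩
  · rw [← hasSum_nat_add_iff' 1] at s1 ⊢
    simp only [Finset.range_one, Finset.sum_singleton] at s1 ⊢
    have h := (s1.mul_left (ν+1)).sub (s2.mul_left (b^2/4))
    have e : jc ν 0 = (ν + 1) * jc (ν + 1) 0 := by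
      simp only [jc]
      have hG := Real.Gamma_pos_of_pos (show 0 < ν + 1 by linarith)
      rw [show ν + 1 + ((0:ℕ):ℝ) + 1 = ν + 1 + 1 by simp, Real.Gamma_add_one (s := ν + 1) (by linarith)]
      have : ν + 1 ≠ 0 := by linarith
      simp
      field_simp
    rw [e]
    rw [show (ν + 1) * L1 - b^2/4 * L2 - (ν + 1) * jc (ν + 1) 0 * b ^ (2 * 0) * gg μ a (p + 2 * ((0:ℕ):ℝ)) = (ν + 1) * (L1 - jc (ν + 1) 0 * b ^ (2 * 0) * gg μ a (p + 2 * ((0:ℕ):ℝ))) - b^2/4 * L2 by ring]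
    refine h.congr_fun fun r => ?_
    rw [jc_rec hν, show p + 2 + 2 * (r:ℝ) = p + 2 * ((r+1:ℕ):ℝ) by push_cast; ring]
    ring
  · refine ((t1.const_mul _).sub (t2.const_mul _)).congr' ?_
    filter_upwards [self_mem_nhdsWithin] with ε hε
    exact (lapR_rec hp hε (jj_scale_subexp hμ ha.le) hν hb.le).symm

lemma Gamma_poch {x : ℝ} (hx : 0 < x) (r : ℕ) : Real.Gamma (x + r) = Real.Gamma x * (ascPochhammer ℝ r).eval x := by
  induction r with
  | zero => simp
  | succ n ih =>
    rw [show x + ((n+1:ℕ):ℝ) = x + n + 1 by push_cast; ring, Real.Gamma_add_one (by positivity), ih, ascPochhammer_succ_eval]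
    ring

lemma rGamma_poch (c : ℝ) (r : ℕ) : 1 / Real.Gamma (c - r) = (-1) ^ r * (ascPochhammer ℝ r).eval (1 - c) * (1 / Real.Gamma c) := by
  induction r with
  | zero => simp
  | succ n ih =>
    rw [← rGamma (c - ((n+1:ℕ):ℝ)), show c - ((n+1:ℕ):ℝ) + 1 = c - n by push_cast; ring, div_eq_mul_one_div, ih, ascPochhammer_succ_eval]
    push_cast
    ring

lemma final_match {a b lam μ ν : ℝ} (ha : 0 < a) (hb : 0 < b)
    (hlam : μ + ν + 1 > lam) (hν : ν > -1) (r : ℕ) :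
    (a/2) ^ μ * (b/2) ^ ν * (jc ν r * b ^ (2 * r) * gg μ a ((μ + ν - lam + 1) + 2 * r)) =
      b ^ ν * Real.Gamma ((μ + ν - lam + 1) / 2) /
          (2 ^ lam * a ^ (ν - lam + 1) * Real.Gamma (ν + 1) *
            Real.Gamma ((lam + μ - ν + 1) / 2)) *
      (((ascPochhammer ℝ r).eval ((μ + ν - lam + 1) / 2) * (ascPochhammer ℝ r).eval ((ν - lam - μ + 1) / 2) /
    (ascPochhammer ℝ r).eval (ν + 1)) * (b ^ 2 / a ^ 2) ^ r / (Nat.factorial r : ℝ)) := by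
  have h1 := Gamma_poch (show 0 < (μ + ν - lam + 1) / 2 by linarith) r
  have h2 := Gamma_poch (show 0 < ν + 1 by linarith) r
  have h3 := rGamma_poch ((lam + μ - ν + 1) / 2) r
  have hG2 : 0 < Real.Gamma (ν + 1) := Real.Gamma_pos_of_pos (by linarith)
  have hP : 0 < (ascPochhammer ℝ r).eval (ν + 1) := ascPochhammer_pos r _ (by linarith)
  simp only [jc, gg]
  rw [show (μ + ν - lam + 1 + 2 * (r:ℝ)) / 2 = (μ + ν - lam + 1) / 2 + r by ring, h1,
    show ν + (r:ℝ) + 1 = ν + 1 + r by ring, h2,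
    show μ + 1 - ((μ + ν - lam + 1) / 2 + r) = (lam + μ - ν + 1) / 2 - r by ring,
    div_eq_mul_one_div _ (Real.Gamma ((lam + μ - ν + 1) / 2 - r)), h3,
    show 1 - (lam + μ - ν + 1) / 2 = (ν - lam - μ + 1) / 2 by ring]
  have p1 : (a/2) ^ μ * (b/2) ^ ν * (2:ℝ) ^ (μ + ν - lam + 1 + 2 * (r:ℝ) - 1) * a ^ (-(μ + ν - lam + 1 + 2 * (r:ℝ)))
      = b ^ ν / (2 ^ lam * a ^ (ν - lam + 1)) * (4 ^ r / a ^ (2 * r)) := by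
    rw [Real.div_rpow ha.le two_pos.le, Real.div_rpow hb.le two_pos.le,
      show μ + ν - lam + 1 + 2 * (r:ℝ) - 1 = μ + ν - lam + ((2 * r : ℕ) : ℝ) by push_cast; ring,
      show -(μ + ν - lam + 1 + 2 * (r:ℝ)) = -μ + -(ν - lam + 1) + -((2 * r : ℕ) : ℝ) by push_cast; ring,
      Real.rpow_add two_pos, Real.rpow_sub two_pos, Real.rpow_add two_pos, Real.rpow_natCast,
      Real.rpow_add ha, Real.rpow_add ha, Real.rpow_neg ha.le, Real.rpow_neg ha.le, Real.rpow_neg ha.le, Real.rpow_natCast,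
      pow_mul (2:ℝ), show (2:ℝ)^2 = 4 by norm_num]
    have := Real.rpow_pos_of_pos ha μ
    have := Real.rpow_pos_of_pos ha (ν - lam + 1)
    have := Real.rpow_pos_of_pos two_pos μ
    have := Real.rpow_pos_of_pos two_pos ν
    have := Real.rpow_pos_of_pos two_pos lam
    field_simp
  have p2 : ((-1:ℝ)) ^ r * (-1) ^ r = 1 := by rw [← mul_pow]; simp
  generalize (ascPochhammer ℝ r).eval (ν + 1) = P1 at *
  generalize (ascPochhammer ℝ r).eval ((ν - lam - μ + 1) / 2) = P2 at *
  generalize (ascPochhammer ℝ r).eval ((μ + ν - lam + 1) / 2) = P3 at *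
  generalize Real.Gamma ((μ + ν - lam + 1) / 2) = G1 at *
  generalize Real.Gamma (ν + 1) = G2 at *
  generalize Real.Gamma ((lam + μ - ν + 1) / 2) = G3 at *
  calc _ = ((a/2) ^ μ * (b/2) ^ ν * (2:ℝ) ^ (μ + ν - lam + 1 + 2 * (r:ℝ) - 1) * a ^ (-(μ + ν - lam + 1 + 2 * (r:ℝ))))
        * ((-1:ℝ) ^ r * (-1) ^ r) * (b ^ (2 * r) / (4 ^ r * (Nat.factorial r) * (G2 * P1)) * (G1 * P3) * P2 * (1 / G3)) := by ring
    _ = b ^ ν / (2 ^ lam * a ^ (ν - lam + 1)) * (4 ^ r / a ^ (2 * r)) * (b ^ (2 * r) / (4 ^ r * (Nat.factorial r) * (G2 * P1)) * (G1 * P3) * P2 * (1 / G3)) := by rw [p1, p2, mul_one]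
    _ = _ := by
      have : (b ^ 2 / a ^ 2) ^ r = b ^ (2 * r) / a ^ (2 * r) := by rw [div_pow, pow_mul, pow_mul]
      rw [this]
      generalize (2:ℝ) ^ lam = X1
      generalize a ^ (ν - lam + 1) = X2
      generalize b ^ ν = X3
      have h4 : (4:ℝ) ^ r ≠ 0 := by positivity
      field_simp

/-- Weber–Schafheitlin type limit, case `0 < b < a`:
`lim_{ε→0+} ∫_0^∞ e^{-εt} t^{-λ} J_μ(at) J_ν(bt) dt` equals the stated
hypergeometric expression. -/
theorem tendsto_weberSchafheitlin_of_lt (a b lam μ ν : ℝ) (hb : 0 < b) (hba : b < a)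
    (hlam : μ + ν + 1 > lam) (hν : ν > -1) (hμ : μ > -1)
    (hΓ : ∀ k : ℕ, (lam + μ - ν + 1) / 2 ≠ -(k : ℝ)) :
    Filter.Tendsto
      (fun ε : ℝ => ∫ t in Set.Ioi (0 : ℝ),
        Real.exp (-ε * t) * t ^ (-lam) * besselJ μ (a * t) * besselJ ν (b * t))
      (nhdsWithin 0 (Set.Ioi 0))
      (nhds (b ^ ν * Real.Gamma ((μ + ν - lam + 1) / 2) /
          (2 ^ lam * a ^ (ν - lam + 1) * Real.Gamma (ν + 1) *
            Real.Gamma ((lam + μ - ν + 1) / 2)) *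
        hyperF ((μ + ν - lam + 1) / 2) ((ν - lam - μ + 1) / 2) (ν + 1) (b ^ 2 / a ^ 2))) := by
  have ha : 0 < a := hb.trans hba
  have hp : 0 < μ + ν - lam + 1 := by linarith
  obtain ⟨L, hs, ht⟩ := main_all hμ hν hp hb hba
  have e : b ^ ν * Real.Gamma ((μ + ν - lam + 1) / 2) /
          (2 ^ lam * a ^ (ν - lam + 1) * Real.Gamma (ν + 1) *
            Real.Gamma ((lam + μ - ν + 1) / 2)) *
        hyperF ((μ + ν - lam + 1) / 2) ((ν - lam - μ + 1) / 2) (ν + 1) (b ^ 2 / a ^ 2)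
      = (a/2) ^ μ * (b/2) ^ ν * L := by
    rw [hyperF, ← tsum_mul_left, ← (hs.mul_left ((a/2) ^ μ * (b/2) ^ ν)).tsum_eq]
    congr 1; funext r
    exact (final_match ha hb hlam hν r).symm
  rw [e]
  refine (ht.const_mul ((a/2) ^ μ * (b/2) ^ ν)).congr fun ε => ?_
  rw [lapR, ← integral_const_mul]
  refine setIntegral_congr_fun measurableSet_Ioi fun t ht => ?_
  have ht0 : 0 < t := ht
  rw [besselJ_eq (by positivity), besselJ_eq (by positivity),
    show a * t / 2 = a / 2 * t by ring, show b * t / 2 = b / 2 * t by ring,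
    Real.mul_rpow (by positivity) ht0.le, Real.mul_rpow (by positivity) ht0.le,
    show μ + ν - lam + 1 - 1 = μ + ν + -lam by ring, Real.rpow_add ht0, Real.rpow_add ht0]
  ring
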